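/- arXiv:1503.05536 — 6 statements merged into one kernel-verified Lean document; each statement's English description precedes it below -/
import Mathlib

section
/- Let N ≥ 3 be an integer. The family of real numbers {tan(kπ/N) : k an integer with 1 ≤ k < N/2 and gcd(k, N) = 1} is linearly independent over ℚ. That is, if a_k are rational numbers with Σ a_k · tan(kπ/N) = 0 (sum over 1 ≤ k < N/2 with gcd(k, N) = 1), then all a_k = 0. -/
/-- A bound for the difference of two inverse powers that is uniform in the exponent. -/
lemma abs_one_div_rpow_sub_le {m x y s : ℝ} (hm : 0 < m) (hx : m ≤ x) (hy : m ≤ y)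
    (hs : 1 ≤ s) (hs' : s ≤ 2) :
    |1 / x ^ s - 1 / y ^ s| ≤ 2 * |x - y| * (1 / m ^ 2 + 1 / m ^ 3) := by
  wlog hxy : x ≤ y generalizing x y
  · rw [abs_sub_comm, abs_sub_comm x]
    exact this hy hx (le_of_not_ge hxy)
  have hx0 : 0 < x := hm.trans_le hx
  have hy0 : 0 < y := hm.trans_le hy
  have hms : 1 / x ^ s ≤ 1 / m + 1 / m ^ 2 := by
    have h1 : 1 / x ^ s ≤ 1 / m ^ s := by gcongr
    refine h1.trans ?_
    rcases le_total m 1 with h | h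
    · have h2 : m ^ (2 : ℝ) ≤ m ^ s := Real.rpow_le_rpow_of_exponent_ge hm h hs'
      rw [Real.rpow_two] at h2
      have h3 : 1 / m ^ s ≤ 1 / m ^ 2 := by gcongr
      have : 0 < 1 / m := by positivity
      linarith
    · have h2 : m ^ (1 : ℝ) ≤ m ^ s := Real.rpow_le_rpow_of_exponent_le h hs
      rw [Real.rpow_one] at h2
      have h3 : 1 / m ^ s ≤ 1 / m := by gcongr
      have : 0 < 1 / m ^ 2 := by positivity
      linarith
  have hB : 1 - s * ((y - x) / y) ≤ (x / y) ^ s := by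
    have := one_add_mul_self_le_rpow_one_add (s := x / y - 1) (p := s)
      (by have : 0 < x / y := by positivity
          linarith) hs
    have e : (y - x) / y = -(x / y - 1) := by field_simp; ring
    rw [add_sub_cancel] at this
    rw [e]
    linarith
  have hle : 1 / y ^ s ≤ 1 / x ^ s := by gcongr
  rw [abs_of_nonneg (by linarith), abs_sub_comm, abs_of_nonneg (by linarith)]
  have hq : (y - x) / y ≤ (y - x) / m := by gcongr
  have hq0 : 0 ≤ (y - x) / y := div_nonneg (by linarith) hy0.le
  calc 1 / x ^ s - 1 / y ^ s = 1 / x ^ s * (1 - (x / y) ^ s) := by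
        rw [Real.div_rpow hx0.le hy0.le]
        field_simp
    _ ≤ (1 / m + 1 / m ^ 2) * (2 * ((y - x) / m)) := by
        have : (x / y) ^ s ≤ 1 := Real.rpow_le_one (by positivity)
          (by rw [div_le_one hy0]; exact hxy) (by linarith)
        apply mul_le_mul hms _ (by linarith) (by positivity)
        nlinarith
    _ = 2 * (y - x) * (1 / m ^ 2 + 1 / m ^ 3) := by field_simp

open Filter Topology in
/-- The value at `s = 1` of the odd Hurwitz zeta function, as a series. -/
lemma hasSum_hurwitzZetaOdd_one {a : ℝ} (ha : 0 < a) (ha' : a < 1) :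
    HasSum (fun n : ℕ ↦ (1 / (n + a : ℂ) - 1 / (n + 1 - a : ℂ)) / 2)
      (HurwitzZeta.hurwitzZetaOdd a 1) := by
  set δ := min a (1 - a) with hδ
  have hδ0 : 0 < δ := lt_min ha (by linarith)
  let f : ℝ → ℕ → ℂ := fun s n ↦
    (1 / (n + a : ℂ) ^ (s : ℂ) - 1 / (n + 1 - a : ℂ) ^ (s : ℂ)) / 2
  let bound : ℕ → ℝ := fun n ↦ 1 / (n + δ) ^ 2 + 1 / (n + δ) ^ 3
  have hsum : Summable bound := by
    have key (k : ℕ) (hk : 1 < k) : Summable fun n : ℕ ↦ 1 / (n + δ) ^ k := by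
      refine ((Real.summable_one_div_nat_add_rpow δ k).2 (by exact_mod_cast hk)).congr fun n ↦ ?_
      rw [abs_of_pos (by positivity), Real.rpow_natCast]
    exact (key 2 (by norm_num)).add (key 3 (by norm_num))
  have hbound (s : ℝ) (hs : 1 ≤ s) (hs' : s ≤ 2) (n : ℕ) : ‖f s n‖ ≤ bound n := by
    have h1 : δ ≤ a := min_le_left _ _
    have h2 : δ ≤ 1 - a := min_le_right _ _
    have hn : (0 : ℝ) ≤ n := Nat.cast_nonneg n
    have e : f s n = ((1 / (n + a) ^ s - 1 / (n + 1 - a) ^ s) / 2 : ℝ) := by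
      simp only [f]
      push_cast
      rw [Complex.ofReal_cpow (by linarith), Complex.ofReal_cpow (by linarith)]
      push_cast
      rfl
    rw [e, Complex.norm_real, Real.norm_eq_abs, abs_div, abs_two]
    have := abs_one_div_rpow_sub_le (m := n + δ) (x := n + a) (y := n + 1 - a) (s := s)
      (by positivity) (by linarith) (by linarith) hs hs'
    have h3 : |(n + a) - (n + 1 - a)| ≤ 1 := by rw [abs_le]; constructor <;> linarith
    have h4 : 0 ≤ bound n := by positivity
    change _ ≤ 2 * _ * bound n at this
    nlinarith
  have hf1 : (fun n : ℕ ↦ (1 / (n + a : ℂ) - 1 / (n + 1 - a : ℂ)) / 2) = f 1 := by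
    ext n
    simp [f]
  rw [hf1]
  have hlim : Tendsto (fun s ↦ ∑' n, f s n) (𝓝[>] 1) (𝓝 (∑' n, f 1 n)) := by
    refine tendsto_tsum_of_dominated_convergence hsum (fun n ↦ ?_) ?_
    · have h1 : (n + a : ℂ) ≠ 0 := by
        have : (0 : ℝ) < n + a := by positivity
        exact_mod_cast this.ne'
      have h2 : (n + 1 - a : ℂ) ≠ 0 := by
        have : (0 : ℝ) < n + 1 - a := by
          have : (0 : ℝ) ≤ n := Nat.cast_nonneg n
          linarith
        exact_mod_cast this.ne'
      have : ContinuousAt (fun s ↦ f s n) 1 := by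
        have hc (z : ℂ) (hz : z ≠ 0) : ContinuousAt (fun s : ℝ ↦ 1 / z ^ (s : ℂ)) 1 :=
          continuousAt_const.div
            (Complex.continuous_ofReal.continuousAt.const_cpow (Or.inl hz)) (by simp [hz])
        exact ((hc _ h1).sub (hc _ h2)).div_const 2
      exact this.tendsto.mono_left nhdsWithin_le_nhds
    · filter_upwards [Ioc_mem_nhdsGT (show (1 : ℝ) < 2 by norm_num)] with s hs n
      exact hbound s hs.1.le hs.2 n
  have hlim' : Tendsto (fun s : ℝ ↦ HurwitzZeta.hurwitzZetaOdd a s) (𝓝[>] 1)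
      (𝓝 (HurwitzZeta.hurwitzZetaOdd a 1)) := by
    have : Continuous (fun s : ℝ ↦ HurwitzZeta.hurwitzZetaOdd a s) :=
      (HurwitzZeta.differentiable_hurwitzZetaOdd a).continuous.comp Complex.continuous_ofReal
    simpa using (this.tendsto 1).mono_left nhdsWithin_le_nhds
  have heq : (fun s ↦ ∑' n, f s n) =ᶠ[𝓝[>] 1]
      fun s : ℝ ↦ HurwitzZeta.hurwitzZetaOdd a s := by
    filter_upwards [self_mem_nhdsWithin] with s hs
    exact (HurwitzZeta.hasSum_nat_hurwitzZetaOdd_of_mem_Icc ⟨ha.le, ha'.le⟩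
      (by simpa using hs)).tsum_eq
  have hval := tendsto_nhds_unique (hlim.congr' heq) hlim'
  rw [← hval]
  exact (Summable.of_norm_bounded hsum (hbound 1 le_rfl one_le_two)).hasSum

open Filter Topology in
/-- The value at `s = 1` of the odd Hurwitz zeta function. -/
lemma hurwitzZetaOdd_one {a : ℝ} (ha : 0 < a) (ha' : a < 1) :
    HurwitzZeta.hurwitzZetaOdd a 1 = Real.pi / 2 * Complex.cot (Real.pi * a) := by
  have hmem : (a : ℂ) ∈ Complex.integerComplement := by
    rintro ⟨n, hn⟩
    have hn' : (n : ℝ) = a := by exact_mod_cast hn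
    have h0 : 0 < n := by exact_mod_cast hn' ▸ ha
    have h1 : n < 1 := by exact_mod_cast hn' ▸ ha'
    omega
  have hcot := tendsto_logDeriv_euler_cot_sub hmem
  have hpart (M : ℕ) : ∑ n ∈ Finset.range M, (1 / (n + a : ℂ) - 1 / (n + 1 - a : ℂ)) / 2 =
      (1 / a + ∑ n ∈ Finset.range M, cotTerm a n) / 2 - 1 / (M + a : ℂ) / 2 := by
    induction M with
    | zero => simp
    | succ M ih =>
      rw [Finset.sum_range_succ, Finset.sum_range_succ, ih, cotTerm]
      have e : (a - (M + 1) : ℂ) = -(M + 1 - a) := by ring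
      rw [e, div_neg]
      push_cast
      ring
  have hzero : Tendsto (fun M : ℕ ↦ 1 / (M + a : ℂ) / 2) atTop (𝓝 0) := by
    have h1 : Tendsto (fun M : ℕ ↦ 1 / (M + a : ℝ)) atTop (𝓝 0) := by
      simp_rw [one_div]
      exact (tendsto_natCast_atTop_atTop.atTop_add tendsto_const_nhds).inv_tendsto_atTop
    have h2 := ((Complex.continuous_ofReal.tendsto 0).comp h1).div_const 2
    simpa [Function.comp_def] using h2
  have h := (hasSum_hurwitzZetaOdd_one ha ha').tendsto_sum_nat
  simp_rw [hpart] at h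
  rw [tendsto_nhds_unique h (((hcot.const_add _).div_const 2).sub hzero)]
  ring

/-- The function on `ZMod N` whose value at the class of `k` is `-i cot (π k / N)`
(and `0` at the zero class). -/
noncomputable def cotChar (N : ℕ) [NeZero N] (j : ZMod N) : ℂ :=
  (ZMod.stdAddChar j + 1) / (ZMod.stdAddChar j - 1)

lemma cot_eq_I_mul_cotChar (N : ℕ) [NeZero N] (k : ℕ) :
    Complex.cot (Real.pi * (k / N : ℝ)) = Complex.I * cotChar N (k : ZMod N) := by
  have h := ZMod.stdAddChar_coe (N := N) (k : ℤ)
  rw [Int.cast_natCast, Int.cast_natCast] at h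
  rw [Complex.cot_pi_eq_exp_ratio, cotChar, h]
  push_cast
  rw [← mul_div_assoc]
  set z := Complex.exp (2 * Real.pi * Complex.I * k / N)
  rw [show z - 1 = -(1 - z) by ring, div_neg, ← div_div, div_right_comm, Complex.div_I]
  ring

lemma sum_mul_cotChar_ne_zero {N : ℕ} [NeZero N] {χ : DirichletCharacter ℂ N} (hχ : χ.Odd) :
    ∑ j, χ j * cotChar N j ≠ 0 := by
  have hχ1 : χ ≠ 1 := by
    rintro rfl
    have := hχ
    rw [DirichletCharacter.Odd, MulChar.one_apply isUnit_one.neg] at this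
    norm_num at this
  have hL := DirichletCharacter.LFunction_apply_one_ne_zero hχ1
  rw [DirichletCharacter.LFunction, ZMod.LFunction_def_odd hχ.to_fun] at hL
  intro h
  apply hL
  have hterm (j : ZMod N) : χ j * HurwitzZeta.hurwitzZetaOdd (ZMod.toAddCircle j) 1 =
      Real.pi / 2 * Complex.I * (χ j * cotChar N j) := by
    rcases eq_or_ne j 0 with rfl | hj
    · simp [cotChar, show χ 0 = 0 from hχ.to_fun.map_zero]
    · have hN : (0 : ℝ) < N := Nat.cast_pos.2 (NeZero.pos N)
      have hpos : (0 : ℝ) < j.val := by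
        exact_mod_cast Nat.pos_of_ne_zero ((ZMod.val_ne_zero j).2 hj)
      have hlt : (j.val : ℝ) < N := by exact_mod_cast j.val_lt
      rw [ZMod.toAddCircle_apply, hurwitzZetaOdd_one (by positivity) ((div_lt_one hN).2 hlt),
        cot_eq_I_mul_cotChar, ZMod.natCast_zmod_val]
      ring
  simp_rw [hterm, ← Finset.mul_sum, h, mul_zero]

/-- Galois conjugation: rational relations between values of `cotChar` are stable under
multiplication of the argument by a unit. -/
lemma sum_mul_cotChar_unit_mul {N : ℕ} [NeZero N] {b : ZMod N → ℚ}
    (h : ∑ j, (b j : ℂ) * cotChar N j = 0) (u : (ZMod N)ˣ) :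
    ∑ j, (b j : ℂ) * cotChar N (u * j) = 0 := by
  have hN : 0 < N := NeZero.pos N
  have hpow (v j : ZMod N) : ZMod.stdAddChar (v * j) = ZMod.stdAddChar v ^ j.val := by
    rw [← AddChar.map_nsmul_eq_pow, nsmul_eq_mul, ZMod.natCast_zmod_val, mul_comm]
  set ζ : ℂ := ZMod.stdAddChar (1 : ZMod N) with hζdef
  have hζ : IsPrimitiveRoot ζ N := by
    have := ZMod.stdAddChar_coe (N := N) 1
    simp only [Int.cast_one, mul_one] at this
    rw [hζdef, this]
    exact Complex.isPrimitiveRoot_exp N hN.ne'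
  have hζu : IsPrimitiveRoot (ZMod.stdAddChar (u : ZMod N) : ℂ) N := by
    rw [← one_mul (u : ZMod N), hpow]
    exact hζ.pow_of_coprime _ (ZMod.val_coe_unit_coprime u)
  have hint : IsIntegral ℚ ζ := (hζ.isIntegral hN).tower_top
  let pb := IntermediateField.adjoin.powerBasis hint
  have hgen : (algebraMap (IntermediateField.adjoin ℚ {ζ}) ℂ) pb.gen = ζ := by
    simp [pb]
  have hroot : Polynomial.aeval (ZMod.stdAddChar (u : ZMod N) : ℂ) (minpoly ℚ pb.gen) = 0 := by
    rw [← minpoly.algebraMap_eq (algebraMap (IntermediateField.adjoin ℚ {ζ}) ℂ).injective, hgen,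
      ← Polynomial.cyclotomic_eq_minpoly_rat hζ hN,
      Polynomial.cyclotomic_eq_minpoly_rat hζu hN, minpoly.aeval]
  let σ := pb.lift _ hroot
  have hσ : σ pb.gen = ZMod.stdAddChar (u : ZMod N) := pb.lift_gen _ hroot
  have hrel : ∑ j : ZMod N, (b j : IntermediateField.adjoin ℚ {ζ}) *
      ((pb.gen ^ j.val + 1) / (pb.gen ^ j.val - 1)) = 0 := by
    apply (algebraMap (IntermediateField.adjoin ℚ {ζ}) ℂ).injective
    simp only [map_sum, map_mul, map_div₀, map_add, map_sub, map_pow, map_one, hgen, map_ratCast,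
      map_zero]
    rw [← h]
    refine Finset.sum_congr rfl fun j _ ↦ ?_
    rw [cotChar, ← one_mul j, hpow 1 j, one_mul]
  have := congrArg σ hrel
  simp only [map_sum, map_mul, map_div₀, map_add, map_sub, map_pow, map_one, hσ, map_ratCast,
    map_zero] at this
  rw [← this]
  exact Finset.sum_congr rfl fun j _ ↦ by rw [cotChar, hpow]

/-- Rational relations between the values of `cotChar` at units come from its oddness. -/
theorem coeff_neg_of_sum_mul_cotChar_eq_zero {N : ℕ} [NeZero N] {b : ZMod N → ℚ}
    (hb : ∀ j, ¬IsUnit j → b j = 0) (h : ∑ j, (b j : ℂ) * cotChar N j = 0) (a : ZMod N) :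
    b a = b (-a) := by
  have hodd (χ : DirichletCharacter ℂ N) (hχ : χ.Odd) : ∑ j, (b j : ℂ) * χ j⁻¹ = 0 := by
    have hterm (j : ZMod N) : ∑ u : ZMod N, χ u * ((b j : ℂ) * cotChar N (u * j)) =
        b j * χ j⁻¹ * ∑ v, χ v * cotChar N v := by
      by_cases hj : IsUnit j
      · obtain ⟨v, rfl⟩ := hj
        rw [Finset.mul_sum]
        refine Fintype.sum_equiv (Units.mulRight v) _ _ fun u ↦ ?_
        have hv : χ ((v : ZMod N)⁻¹) * χ v = 1 := by
          rw [← map_mul, ZMod.inv_mul_of_unit _ v.isUnit, map_one]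
        simp only [Units.mulRight_apply, map_mul]
        linear_combination (-(b v : ℂ) * χ u * cotChar N (u * v)) * hv
      · simp [hb j hj]
    have hzero : ∑ u : ZMod N, χ u * ∑ j, (b j : ℂ) * cotChar N (u * j) = 0 := by
      refine Finset.sum_eq_zero fun u _ ↦ ?_
      by_cases hu : IsUnit u
      · obtain ⟨u, rfl⟩ := hu
        rw [sum_mul_cotChar_unit_mul h u, mul_zero]
      · rw [χ.map_nonunit hu, zero_mul]
    simp_rw [Finset.mul_sum] at hzero
    rw [Finset.sum_comm] at hzero
    simp_rw [hterm, ← Finset.sum_mul] at hzero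
    exact (mul_eq_zero.1 hzero).resolve_right (sum_mul_cotChar_ne_zero hχ)
  have hall (χ : DirichletCharacter ℂ N) : ∑ j, ((b j : ℂ) - b (-j)) * χ j⁻¹ = 0 := by
    have hneg : ∑ j, (b (-j) : ℂ) * χ j⁻¹ = χ (-1) * ∑ j, (b j : ℂ) * χ j⁻¹ := by
      rw [Finset.mul_sum]
      refine Fintype.sum_equiv (Equiv.neg _) _ _ fun j ↦ ?_
      by_cases hj : IsUnit j
      · obtain ⟨v, rfl⟩ := hj
        have e : ((-(v : ZMod N))⁻¹) = -1 * (v : ZMod N)⁻¹ := by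
          rw [← Units.val_neg, ZMod.inv_coe_unit, ZMod.inv_coe_unit, inv_neg, Units.val_neg]
          ring
        have h1 : χ (-1) * χ (-1) = 1 := by rw [← map_mul]; simp
        rw [Equiv.neg_apply, e, map_mul]
        linear_combination (-(b (-v) : ℂ) * χ (v : ZMod N)⁻¹) * h1
      · have : ¬IsUnit (-j) := by rwa [IsUnit.neg_iff]
        simp [hb _ this]
    simp_rw [sub_mul, Finset.sum_sub_distrib, hneg]
    rcases χ.even_or_odd with hχ | hχ
    · rw [DirichletCharacter.Even] at hχ
      rw [hχ]
      ring
    · rw [hodd χ hχ]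
      ring
  have hfin : ∑ χ : DirichletCharacter ℂ N, χ a * ∑ j, ((b j : ℂ) - b (-j)) * χ j⁻¹ = 0 := by
    simp [hall]
  simp_rw [Finset.mul_sum] at hfin
  rw [Finset.sum_comm] at hfin
  have hterm (j : ZMod N) : ∑ χ : DirichletCharacter ℂ N, χ a * (((b j : ℂ) - b (-j)) * χ j⁻¹) =
      if j = a then ((b j : ℂ) - b (-j)) * N.totient else 0 := by
    by_cases hj : IsUnit j
    · have := DirichletCharacter.sum_char_inv_mul_char_eq ℂ hj a
      rw [← mul_ite_zero, ← this, Finset.mul_sum]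
      exact Finset.sum_congr rfl fun χ _ ↦ by ring
    · have h' : ¬IsUnit (-j) := by rwa [IsUnit.neg_iff]
      simp [hb _ hj, hb _ h']
  simp_rw [hterm] at hfin
  rw [Finset.sum_ite_eq' Finset.univ a, if_pos (Finset.mem_univ a)] at hfin
  have hφ : (N.totient : ℂ) ≠ 0 := by
    exact_mod_cast (Nat.totient_pos.2 (NeZero.pos N)).ne'
  exact_mod_cast sub_eq_zero.1 ((mul_eq_zero.1 hfin).resolve_right hφ)

/-- For `k` coprime to `N`, the fraction `(N - 2k) / (2N)` has a reduced form whose denominator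
depends only on `N`. -/
lemma exists_reduced_denominator (N : ℕ) :
    ∃ d M : ℕ, d * M = 2 * N ∧ ∀ k : ℕ, 2 * k < N → Nat.gcd k N = 1 →
      ∃ g : ℕ, d * g = N - 2 * k ∧ Nat.Coprime g M := by
  have coprime_of_prime {g M : ℕ} (H : ∀ p, p.Prime → p ∣ g → p ∣ M → False) :
      Nat.Coprime g M := Nat.coprime_of_dvd fun p hp h1 h2 ↦ H p hp h1 h2
  have not_dvd_both {k p : ℕ} (hp : p.Prime) (hk : Nat.gcd k N = 1) (h1 : p ∣ k) (h2 : p ∣ N) :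
      False := hp.one_lt.ne' (Nat.dvd_one.1 (hk ▸ Nat.dvd_gcd h1 h2))
  rcases Nat.even_or_odd' N with ⟨m, rfl | rfl⟩
  · rcases Nat.even_or_odd' m with ⟨l, rfl | rfl⟩
    · refine ⟨2, 2 * (2 * l), rfl, fun k hk hgcd ↦ ⟨2 * l - k, by omega, ?_⟩⟩
      refine coprime_of_prime fun p hp h1 h2 ↦ ?_
      have hl : p ∣ 2 * l := by
        rcases hp.dvd_mul.1 h2 with h | h
        · exact h.mul_right l
        · exact h
      exact not_dvd_both hp hgcd ((Nat.dvd_sub_iff_right (by omega) hl).1 h1) h2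
    · refine ⟨4, 2 * l + 1, by ring, fun k hk hgcd ↦ ?_⟩
      have hodd : ¬ 2 ∣ k := fun h ↦ not_dvd_both Nat.prime_two hgcd h ⟨_, rfl⟩
      obtain ⟨g, hg⟩ : 2 ∣ 2 * l + 1 - k := by omega
      refine ⟨g, by omega, coprime_of_prime fun p hp h1 h2 ↦ ?_⟩
      have h3 : p ∣ 2 * l + 1 - k := hg ▸ h1.mul_left 2
      exact not_dvd_both hp hgcd ((Nat.dvd_sub_iff_right (by omega) h2).1 h3) (h2.mul_left 2)
  · refine ⟨1, 2 * (2 * m + 1), one_mul _, fun k hk hgcd ↦ ⟨2 * m + 1 - 2 * k, one_mul _, ?_⟩⟩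
    refine coprime_of_prime fun p hp h1 h2 ↦ ?_
    have hp2 : ¬ p ∣ 2 := fun h ↦ by
      obtain rfl := (Nat.prime_dvd_prime_iff_eq hp Nat.prime_two).1 h
      omega
    have hpN := (hp.dvd_mul.1 h2).resolve_left hp2
    have h3 := (Nat.dvd_sub_iff_right (by omega) hpN).1 h1
    exact not_dvd_both hp hgcd ((hp.dvd_mul.1 h3).resolve_left hp2) hpN

/-- Siegel–Chowla–Girstmair independence (tangent case): for `N ≥ 3`, the
primitive star points `tan(kπ/N)`, for integers `1 ≤ k < N/2` with
`gcd(k, N) = 1`, are linearly independent over `ℚ`. -/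
theorem tan_primitive_star_points_linearIndependent
    (N : ℕ) (hN : 3 ≤ N) (a : ℕ → ℚ)
    (h : ∑ k ∈ Finset.filter (fun k => 1 ≤ k ∧ 2 * k < N ∧ Nat.gcd k N = 1) (Finset.range N),
        (a k : ℝ) * Real.tan (k * Real.pi / N) = 0) :
    ∀ k : ℕ, 1 ≤ k → 2 * k < N → Nat.gcd k N = 1 → a k = 0 := by
  intro k hk1 hk2 hk3
  obtain ⟨d, M, hdM, hred⟩ := exists_reduced_denominator N
  have hd : 0 < d := Nat.pos_of_ne_zero fun h0 ↦ by
    rw [h0] at hdM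
    omega
  have hM : 0 < M := Nat.pos_of_ne_zero fun h0 ↦ by
    rw [h0] at hdM
    omega
  have : NeZero M := ⟨hM.ne'⟩
  choose! g hg hcop using hred
  set S := Finset.filter (fun k => 1 ≤ k ∧ 2 * k < N ∧ Nat.gcd k N = 1) (Finset.range N)
  have hS {i : ℕ} (hi : i ∈ S) : 1 ≤ i ∧ 2 * i < N ∧ Nat.gcd i N = 1 := (Finset.mem_filter.1 hi).2
  have hkS : k ∈ S := Finset.mem_filter.2 ⟨Finset.mem_range.2 (by omega), hk1, hk2, hk3⟩
  have hlt {i : ℕ} (hi : i ∈ S) : 2 * g i < M := by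
    obtain ⟨h1, h2, h3⟩ := hS hi
    have := hg i h2 h3
    refine Nat.lt_of_mul_lt_mul_left (a := d) ?_
    rw [hdM, mul_left_comm, this]
    omega
  have hgpos {i : ℕ} (hi : i ∈ S) : 0 < g i := by
    obtain ⟨h1, h2, h3⟩ := hS hi
    have := hg i h2 h3
    exact Nat.pos_of_ne_zero fun h0 ↦ by
      rw [h0] at this
      omega
  let b : ZMod M → ℚ := fun x ↦ ∑ i ∈ S, if (g i : ZMod M) = x then a i else 0
  have hb (j : ZMod M) (hj : ¬IsUnit j) : b j = 0 := by
    refine Finset.sum_eq_zero fun i hi ↦ if_neg ?_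
    rintro rfl
    exact hj ((ZMod.isUnit_iff_coprime _ _).2 (hcop i (hS hi).2.1 (hS hi).2.2))
  have htan {i : ℕ} (hi : i ∈ S) :
      ((Real.tan (i * Real.pi / N) : ℝ) : ℂ) = Complex.I * cotChar M (g i : ZMod M) := by
    obtain ⟨h1, h2, h3⟩ := hS hi
    have hgi : (d : ℝ) * g i = N - 2 * i := by
      rw [← Nat.cast_mul, hg i h2 h3, Nat.cast_sub h2.le]
      push_cast
      ring
    have hdM' : (d : ℝ) * M = 2 * N := by exact_mod_cast hdM
    have hM' : (0 : ℝ) < M := by exact_mod_cast hM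
    have hd' : (0 : ℝ) < d := by exact_mod_cast hd
    have hN' : (0 : ℝ) < N := by
      have : 0 < N := by omega
      exact_mod_cast this
    have harg : Real.pi * (g i / M) = Real.pi / 2 - i * Real.pi / N := by
      have : (g i / M : ℝ) = 1 / 2 - i / N := by
        have : (g i / M : ℝ) = (d * g i) / (d * M) := by field_simp
        rw [this, hgi, hdM']
        field_simp
      rw [this]
      ring
    rw [← cot_eq_I_mul_cotChar, ← Complex.ofReal_mul, harg, ← Complex.ofReal_cot,
      Real.cot_eq_cos_div_sin, Real.cos_pi_div_two_sub, Real.sin_pi_div_two_sub,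
      ← Real.tan_eq_sin_div_cos]
  have hsum : ∑ j, (b j : ℂ) * cotChar M j = 0 := by
    have hC : ∑ i ∈ S, (a i : ℂ) * cotChar M (g i : ZMod M) = 0 := by
      have : Complex.I * ∑ i ∈ S, (a i : ℂ) * cotChar M (g i : ZMod M) = 0 := by
        rw [← Complex.ofReal_zero, ← h, Complex.ofReal_sum, Finset.mul_sum]
        refine Finset.sum_congr rfl fun i hi ↦ ?_
        rw [Complex.ofReal_mul, htan hi, Complex.ofReal_ratCast]
        ring
      exact (mul_eq_zero.1 this).resolve_left Complex.I_ne_zero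
    rw [← hC]
    simp only [b, Rat.cast_sum, Finset.sum_mul]
    rw [Finset.sum_comm]
    refine Finset.sum_congr rfl fun i _ ↦ ?_
    simp [apply_ite (Rat.cast : ℚ → ℂ)]
  have hval := coeff_neg_of_sum_mul_cotChar_eq_zero hb hsum (g k : ZMod M)
  have hbk : b (g k) = a k := by
    refine (Finset.sum_eq_single_of_mem k hkS fun i hi hik ↦ if_neg fun heq ↦ hik ?_).trans
      (if_pos rfl)
    have hi' := hlt hi
    have hk' := hlt hkS
    rw [ZMod.natCast_eq_natCast_iff', Nat.mod_eq_of_lt (by omega),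
      Nat.mod_eq_of_lt (by omega)] at heq
    have h1 := hg i (hS hi).2.1 (hS hi).2.2
    have h2 := hg k hk2 hk3
    have h3 := (hS hi).2.1
    rw [heq] at h1
    omega
  have hbneg : b (-(g k : ZMod M)) = 0 := by
    refine Finset.sum_eq_zero fun i hi ↦ if_neg fun heq ↦ ?_
    have hi' := hlt hi
    have hk' := hlt hkS
    have hpos := hgpos hi
    have hz : ((g i + g k : ℕ) : ZMod M) = 0 := by
      push_cast
      rw [heq]
      ring
    have := Nat.le_of_dvd (by omega) ((ZMod.natCast_eq_zero_iff _ _).1 hz)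
    omega
  rw [← hbk, hval, hbneg]
end

section
/- Let N ≥ 3 be an integer. The family of real numbers {cot(kπ/N) : k an integer with 1 ≤ k < N/2 and gcd(k, N) = 1} is linearly independent over ℚ. That is, if a_k are rational numbers with Σ a_k · cot(kπ/N) = 0 (sum over 1 ≤ k < N/2 with gcd(k, N) = 1), then all a_k = 0. -/
open Filter Topology

/-- Dominating estimate for the terms of the Dirichlet series of `hurwitzZetaOdd` near `s = 1`. -/
lemma abs_rpow_neg_sub_rpow_neg_le {m u v s : ℝ} (hm1 : 1 ≤ m) (hu : u ∈ Set.Icc m (m + 1))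
    (hv : v ∈ Set.Icc m (m + 1)) (hs : s ∈ Set.Icc (1 : ℝ) 2) :
    |u ^ (-s) - v ^ (-s)| ≤ 2 / m ^ 2 := by
  obtain ⟨hs1, hs2⟩ := hs
  have hm : 0 < m := by linarith
  have hle : ∀ {a b : ℝ}, 0 < a → a ≤ b → b ^ (-s) ≤ a ^ (-s) := fun ha hab ↦
    Real.rpow_le_rpow_of_nonpos ha hab (by linarith)
  have key : m ^ (-s) - (m + 1) ^ (-s) ≤ 2 / m ^ 2 := by
    have hr0 : 0 < m / (m + 1) := by positivity
    have hr1 : m / (m + 1) ≤ 1 := by rw [div_le_one (by positivity)]; linarith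
    have e1 : (m + 1) ^ (-s) = m ^ (-s) * (m / (m + 1)) ^ s := by
      rw [Real.div_rpow hm.le (by positivity), Real.rpow_neg hm.le, Real.rpow_neg (by positivity)]
      have := (Real.rpow_pos_of_pos hm s).ne'
      field_simp
    have e2 : (m / (m + 1)) ^ 2 ≤ (m / (m + 1)) ^ s := by
      rw [← Real.rpow_two]
      exact Real.rpow_le_rpow_of_exponent_ge hr0 hr1 hs2
    have e3 : m ^ (-s) ≤ m⁻¹ := by
      rw [← Real.rpow_neg_one]
      exact Real.rpow_le_rpow_of_exponent_le hm1 (by linarith)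
    calc m ^ (-s) - (m + 1) ^ (-s) = m ^ (-s) * (1 - (m / (m + 1)) ^ s) := by rw [e1]; ring
      _ ≤ m⁻¹ * (1 - (m / (m + 1)) ^ 2) := by
        gcongr
        have := Real.rpow_le_one hr0.le hr1 (by linarith : 0 ≤ s)
        linarith
      _ ≤ 2 / m ^ 2 := by
        have : m⁻¹ * (1 - (m / (m + 1)) ^ 2) = (2 * m + 1) / (m * (m + 1) ^ 2) := by
          field_simp; ring
        rw [this, div_le_div_iff₀ (by positivity) (by positivity)]
        nlinarith [pow_pos hm 2]
  have h1 := hle hm hu.1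
  have h2 := hle (by linarith [hu.1]) hu.2
  have h3 := hle hm hv.1
  have h4 := hle (by linarith [hv.1]) hv.2
  rw [abs_le]
  constructor <;> linarith

lemma tsum_one_div_add_sub_one_div {x : ℝ} (hx : x ∈ Set.Ioo (0 : ℝ) 1)
    (hs : Summable fun n : ℕ ↦ (1 / (n + x : ℂ) - 1 / (n + 1 - x : ℂ))) :
    ∑' n : ℕ, (1 / (n + x : ℂ) - 1 / (n + 1 - x : ℂ)) = Real.pi * Complex.cot (Real.pi * x) := by
  have hxc : (x : ℂ) ∈ Complex.integerComplement := by
    rintro ⟨n, hn⟩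
    have hn' : (n : ℝ) = x := by exact_mod_cast hn
    have h0 : (0 : ℝ) < n := hn' ▸ hx.1
    have h1 : (n : ℝ) < 1 := hn' ▸ hx.2
    norm_cast at h0 h1
    omega
  refine tendsto_nhds_unique hs.hasSum.tendsto_sum_nat ?_
  have hlim : Tendsto (fun n : ℕ ↦ 1 / (n + x : ℂ)) atTop (𝓝 0) := by
    have : Tendsto (fun n : ℕ ↦ ((1 / (n + x) : ℝ) : ℂ)) atTop (𝓝 ((0 : ℝ) : ℂ)) := by
      refine (Complex.continuous_ofReal.tendsto _).comp ?_
      exact tendsto_const_nhds.div_atTop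
        (tendsto_atTop_add_const_right _ _ tendsto_natCast_atTop_atTop)
    simpa using this
  have := ((tendsto_logDeriv_euler_cot_sub hxc).const_add (1 / (x : ℂ))).sub hlim
  rw [sub_zero, add_sub_cancel] at this
  refine this.congr fun n ↦ ?_
  induction n with
  | zero => simp
  | succ n ih =>
    rw [Finset.sum_range_succ, Finset.sum_range_succ, ← ih, cotTerm]
    have : 1 / ((x : ℂ) - (n + 1)) = - (1 / (n + 1 - x : ℂ)) := by
      rw [← neg_sub, one_div_neg_eq_neg_one_div]
    rw [this]
    push_cast
    ring

/-- The odd Hurwitz zeta function at `s = 1` is a cotangent. -/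
lemma hurwitzZetaOdd_apply_one {x : ℝ} (hx : x ∈ Set.Ioo (0 : ℝ) 1) :
    HurwitzZeta.hurwitzZetaOdd x 1 = Real.pi / 2 * Complex.cot (Real.pi * x) := by
  obtain ⟨hx0, hx1⟩ := hx
  set f : ℝ → ℕ → ℂ := fun s n ↦ (((n + x) ^ (-s) - (n + 1 - x) ^ (-s) : ℝ) : ℂ) with hf
  set bound : ℕ → ℝ := fun n ↦
    2 / (n : ℝ) ^ 2 + if n = 0 then x ^ (-2 : ℝ) + (1 - x) ^ (-2 : ℝ) else 0 with hbound
  have hpos1 (n : ℕ) : 0 < n + x := by positivity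
  have hpos2 (n : ℕ) : 0 < n + 1 - x := by linarith [n.cast_nonneg (α := ℝ)]
  have hsum : Summable bound := by
    refine .add ?_ (hasSum_ite_eq 0 _).summable
    simpa [div_eq_mul_inv] using (Real.summable_one_div_nat_pow.mpr one_lt_two).mul_left 2
  have hle {s : ℝ} (hs : s ∈ Set.Icc (1 : ℝ) 2) (n : ℕ) : ‖f s n‖ ≤ bound n := by
    rw [hf, hbound, Complex.norm_real, Real.norm_eq_abs]
    rcases n.eq_zero_or_pos with rfl | hn
    · simp only [Nat.cast_zero, zero_add, if_true]
      have h1 := Real.rpow_le_rpow_of_exponent_ge hx0 hx1.le (neg_le_neg hs.2)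
      have h2 := Real.rpow_le_rpow_of_exponent_ge (sub_pos.mpr hx1) (by linarith) (neg_le_neg hs.2)
      have h3 := Real.rpow_pos_of_pos hx0 (-s)
      have h4 := Real.rpow_pos_of_pos (sub_pos.mpr hx1) (-s)
      rw [abs_le]
      norm_num only [ne_eq, OfNat.ofNat_ne_zero, not_false_eq_true, zero_pow, div_zero, zero_add]
      constructor <;> linarith
    · have : (1 : ℝ) ≤ n := by exact_mod_cast hn
      simp only [hn.ne', if_false, add_zero]
      refine abs_rpow_neg_sub_rpow_neg_le this ?_ ?_ hs <;>
        constructor <;> linarith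
  have hlim (n : ℕ) : Tendsto (f · n) (𝓝[>] 1) (𝓝 (f 1 n)) := by
    have h1 : Continuous (f · n) := by
      refine Complex.continuous_ofReal.comp (.sub ?_ ?_)
      · exact continuous_const.rpow continuous_neg fun _ ↦ .inl (hpos1 n).ne'
      · exact continuous_const.rpow continuous_neg fun _ ↦ .inl (hpos2 n).ne'
    exact h1.continuousAt.tendsto.mono_left nhdsWithin_le_nhds
  have htsum := tendsto_tsum_of_dominated_convergence hsum hlim (by
    filter_upwards [Ioo_mem_nhdsGT (one_lt_two (α := ℝ))] with s hs n
    exact hle ⟨hs.1.le, hs.2.le⟩ n)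
  have hf1 (n : ℕ) : f 1 n = 1 / (n + x : ℂ) - 1 / (n + 1 - x : ℂ) := by
    simp only [hf, Real.rpow_neg_one]
    push_cast
    simp
  have hfs (s : ℝ) (n : ℕ) :
      f s n / 2 = (1 / (n + x : ℂ) ^ (s : ℂ) - 1 / (n + 1 - x : ℂ) ^ (s : ℂ)) / 2 := by
    simp only [hf]
    rw [Real.rpow_neg (hpos1 n).le, Real.rpow_neg (hpos2 n).le, Complex.ofReal_sub,
      Complex.ofReal_inv, Complex.ofReal_inv, Complex.ofReal_cpow (hpos1 n).le,
      Complex.ofReal_cpow (hpos2 n).le]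
    push_cast
    simp
  have hcont : Tendsto (fun s : ℝ ↦ HurwitzZeta.hurwitzZetaOdd x s) (𝓝[>] 1)
      (𝓝 (HurwitzZeta.hurwitzZetaOdd x 1)) := by
    have : Tendsto (fun s : ℝ ↦ HurwitzZeta.hurwitzZetaOdd x s) (𝓝 1) _ :=
      ((HurwitzZeta.differentiable_hurwitzZetaOdd x).continuous.comp
        Complex.continuous_ofReal).tendsto 1
    simpa using this.mono_left nhdsWithin_le_nhds
  have hval : ∑' n, f 1 n = Real.pi * Complex.cot (Real.pi * x) := by
    simp_rw [hf1]
    refine tsum_one_div_add_sub_one_div ⟨hx0, hx1⟩ ?_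
    simp_rw [← hf1]
    exact .of_norm_bounded hsum (hle ⟨le_rfl, one_le_two⟩)
  refine tendsto_nhds_unique hcont ?_
  have := htsum.div_const 2
  rw [hval, mul_div_right_comm] at this
  refine this.congr' ?_
  filter_upwards [self_mem_nhdsWithin] with s hs
  have := HurwitzZeta.hasSum_nat_hurwitzZetaOdd_of_mem_Icc (a := x) (s := s) ⟨hx0.le, hx1.le⟩
    (by simpa using hs)
  rw [← this.tsum_eq, ← tsum_div_const]
  simp_rw [hfs]

/-- Inverting `1 - w` for an `N`-th root of unity `w ≠ 1` by a polynomial in `w`. -/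
lemma one_add_div_one_sub_eq_sum {N : ℕ} (hN : 0 < N) {w : ℂ} (hw : w ^ N = 1) (hw1 : w ≠ 1) :
    (w + 1) / (1 - w) = -1 - 2 / N * ∑ j ∈ Finset.range N, (j : ℂ) * w ^ j := by
  have hsum (n : ℕ) : (1 - w) * ∑ j ∈ Finset.range n, (j : ℂ) * w ^ j =
      ∑ j ∈ Finset.range n, w ^ j - 1 - (n - 1) * w ^ n := by
    induction n with
    | zero => simp
    | succ n ih =>
      rw [Finset.sum_range_succ, mul_add, ih, Finset.sum_range_succ]
      push_cast
      ring
  have hgeom : ∑ j ∈ Finset.range N, w ^ j = 0 := by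
    rw [geom_sum_eq hw1, hw, sub_self, zero_div]
  have h := hsum N
  rw [hgeom, hw] at h
  have h1 : 1 - w ≠ 0 := sub_ne_zero.mpr hw1.symm
  have hN' : (N : ℂ) ≠ 0 := by exact_mod_cast hN.ne'
  rw [div_eq_iff h1]
  field_simp
  linear_combination 2 * h

/-- A rational linear relation between the values `(1 + ζ ^ k) / (1 - ζ ^ k)` is preserved by
the Galois action `ζ ↦ ζ ^ t`. -/
lemma IsPrimitiveRoot.sum_one_add_div_one_sub_pow_eq_zero {N : ℕ} (hN : 0 < N) {ζ : ℂ}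
    (hζ : IsPrimitiveRoot ζ N) {S : Finset ℕ} (hS : ∀ k ∈ S, ¬ N ∣ k) {a : ℕ → ℚ}
    (h : ∑ k ∈ S, (a k : ℂ) * ((ζ ^ k + 1) / (1 - ζ ^ k)) = 0) {t : ℕ} (ht : t.Coprime N) :
    ∑ k ∈ S, (a k : ℂ) * (((ζ ^ t) ^ k + 1) / (1 - (ζ ^ t) ^ k)) = 0 := by
  let P : Polynomial ℚ := ∑ k ∈ S, Polynomial.C (a k) *
    (-1 - Polynomial.C (2 / N : ℚ) * ∑ j ∈ Finset.range N, (j : Polynomial ℚ) * (.X ^ k) ^ j)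
  have hP {μ : ℂ} (hμ : IsPrimitiveRoot μ N) : Polynomial.aeval μ P =
      ∑ k ∈ S, (a k : ℂ) * ((μ ^ k + 1) / (1 - μ ^ k)) := by
    simp only [P, map_sum, map_mul, map_sub, map_neg, map_one, map_pow, map_natCast,
      Polynomial.aeval_X, Polynomial.aeval_C]
    refine Finset.sum_congr rfl fun k hk ↦ ?_
    rw [one_add_div_one_sub_eq_sum hN (w := μ ^ k)]
    · simp
    · rw [pow_right_comm, hμ.pow_eq_one, one_pow]
    · exact fun h1 ↦ hS k hk (hμ.dvd_of_pow_eq_one k h1)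
  have hζt := hζ.pow_of_coprime t ht
  rw [← hP hζt]
  rw [← hP hζ, ← minpoly.dvd_iff, ← Polynomial.cyclotomic_eq_minpoly_rat hζ hN,
    Polynomial.cyclotomic_eq_minpoly_rat hζt hN, minpoly.dvd_iff] at h
  exact h

lemma Complex.cot_pi_mul_val_div {N : ℕ} [NeZero N] (z : ZMod N) :
    Complex.cot (Real.pi * (z.val / N : ℝ)) =
      (ZMod.stdAddChar z + 1) / (1 - ZMod.stdAddChar z) / Complex.I := by
  have : ZMod.stdAddChar z = Complex.exp (2 * Real.pi * Complex.I * (z.val / N : ℝ)) := by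
    have := ZMod.stdAddChar_coe (N := N) (z.val : ℤ)
    rw [Int.cast_natCast, ZMod.natCast_zmod_val] at this
    rw [this]
    push_cast
    ring_nf
  rw [Complex.cot_pi_eq_exp_ratio, this, div_div, mul_comm Complex.I]

/-- The cotangent sum attached to an odd Dirichlet character is a nonzero multiple of `L(1, χ)`. -/
lemma DirichletCharacter.Odd.sum_mul_cot_ne_zero {N : ℕ} [NeZero N] {χ : DirichletCharacter ℂ N}
    (hχ : χ.Odd) : ∑ z : ZMod N, χ z * Complex.cot (Real.pi * (z.val / N : ℝ)) ≠ 0 := by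
  have hne : χ ≠ 1 := by
    rintro rfl
    have h : (1 : DirichletCharacter ℂ N) (-1) = -1 := hχ
    rw [MulChar.one_apply isUnit_one.neg] at h
    norm_num at h
  have hχ0 : χ 0 = 0 := by
    have := hχ.eval_neg χ 0
    rw [neg_zero, self_eq_neg] at this
    exact this
  have hL := DirichletCharacter.LFunction_apply_one_ne_zero hne
  rw [DirichletCharacter.LFunction, ZMod.LFunction_def_odd (fun z ↦ hχ.eval_neg χ z)] at hL
  intro h
  refine right_ne_zero_of_mul hL ?_
  trans ∑ z : ZMod N, Real.pi / 2 * (χ z * Complex.cot (Real.pi * (z.val / N : ℝ)))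
  · refine Finset.sum_congr rfl fun z _ ↦ ?_
    rcases eq_or_ne z 0 with rfl | hz
    · simp [hχ0]
    · have hN : (0 : ℝ) < N := by exact_mod_cast NeZero.pos N
      have hz0 : (0 : ℝ) < z.val := by exact_mod_cast ZMod.val_pos.mpr hz
      have hz1 : (z.val : ℝ) < N := by exact_mod_cast z.val_lt
      rw [ZMod.toAddCircle_apply,
        hurwitzZetaOdd_apply_one ⟨by positivity, (div_lt_one hN).mpr hz1⟩]
      ring
  · rw [← Finset.mul_sum, h, mul_zero]

/-- If a combination of the translates of a function on `ZMod N` by units vanishes, then so does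
the corresponding character sum, provided that the function pairs nontrivially with `χ`. -/
lemma DirichletCharacter.sum_mul_inv_eq_zero_of_translates {N : ℕ} [NeZero N]
    {χ : DirichletCharacter ℂ N} {F : ZMod N → ℂ} (hF : ∑ z, χ z * F z ≠ 0) {S : Finset ℕ}
    (hS : ∀ k ∈ S, k.Coprime N) {a : ℕ → ℂ}
    (h : ∀ t : ZMod N, IsUnit t → ∑ k ∈ S, a k * F (t * k) = 0) :
    ∑ k ∈ S, a k * χ (k : ZMod N)⁻¹ = 0 := by
  refine (mul_eq_zero.mp ?_).resolve_right hF
  calc (∑ k ∈ S, a k * χ (k : ZMod N)⁻¹) * ∑ z, χ z * F z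
      = ∑ k ∈ S, ∑ t, χ t * (a k * F (t * k)) := by
        rw [Finset.sum_mul]
        refine Finset.sum_congr rfl fun k hk ↦ ?_
        have hk := (ZMod.isUnit_iff_coprime k N).mpr (hS k hk)
        rw [mul_assoc, Finset.mul_sum, ← hk.unit.mulRight_bijective.sum_comp, Finset.mul_sum]
        refine Finset.sum_congr rfl fun t _ ↦ ?_
        have : χ (k : ZMod N)⁻¹ * χ k = 1 := by
          rw [← map_mul, ZMod.inv_mul_of_unit _ hk, map_one]
        rw [IsUnit.unit_spec, map_mul]
        linear_combination (χ t * a k * F (t * k)) * this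
    _ = 0 := by
        rw [Finset.sum_comm]
        refine Finset.sum_eq_zero fun t _ ↦ ?_
        rw [← Finset.mul_sum]
        by_cases ht : IsUnit t
        · rw [h t ht, mul_zero]
        · rw [χ.map_nonunit ht, zero_mul]

/-- A function on representatives of the units modulo `± 1` is determined by its odd
character sums. -/
lemma DirichletCharacter.eq_zero_of_forall_odd_sum_eq_zero {N : ℕ} [NeZero N] {S : Finset ℕ}
    (hS : ∀ k ∈ S, 1 ≤ k ∧ 2 * k < N ∧ k.Coprime N) {a : ℕ → ℂ}
    (h : ∀ χ : DirichletCharacter ℂ N, χ.Odd → ∑ k ∈ S, a k * χ (k : ZMod N)⁻¹ = 0)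
    {l : ℕ} (hl : l ∈ S) : a l = 0 := by
  have hunit (k : ℕ) (hk : k ∈ S) : IsUnit (k : ZMod N) :=
    (ZMod.isUnit_iff_coprime k N).mpr (hS k hk).2.2
  have hzero : ∑ χ : DirichletCharacter ℂ N,
      (χ l - χ (-l)) * ∑ k ∈ S, a k * χ (k : ZMod N)⁻¹ = 0 := by
    refine Finset.sum_eq_zero fun χ _ ↦ ?_
    rcases χ.even_or_odd with hχ | hχ
    · rw [hχ.eval_neg, sub_self, zero_mul]
    · rw [h χ hχ, mul_zero]
  have hne (k : ℕ) (hk : k ∈ S) : (k : ZMod N) ≠ -l := by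
    intro he
    have : ((k + l : ℕ) : ZMod N) = 0 := by rw [Nat.cast_add, he, neg_add_cancel]
    rw [ZMod.natCast_eq_zero_iff] at this
    have := Nat.le_of_dvd (by linarith [(hS k hk).1]) this
    have := (hS k hk).2.1
    have := (hS l hl).2.1
    omega
  have heq (k : ℕ) (hk : k ∈ S) : (k : ZMod N) = l ↔ k = l := by
    rw [ZMod.natCast_eq_natCast_iff', Nat.mod_eq_of_lt (by linarith [(hS k hk).2.1]),
      Nat.mod_eq_of_lt (by linarith [(hS l hl).2.1])]
  have hcalc : ∑ χ : DirichletCharacter ℂ N,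
      (χ l - χ (-l)) * ∑ k ∈ S, a k * χ (k : ZMod N)⁻¹ = a l * N.totient := by
    simp_rw [Finset.mul_sum]
    rw [Finset.sum_comm]
    trans ∑ k ∈ S, if k = l then a k * N.totient else 0
    · refine Finset.sum_congr rfl fun k hk ↦ ?_
      have h1 := DirichletCharacter.sum_char_inv_mul_char_eq ℂ (hunit k hk) (l : ZMod N)
      have h2 := DirichletCharacter.sum_char_inv_mul_char_eq ℂ (hunit k hk) (-l : ZMod N)
      rw [if_neg (hne k hk)] at h2
      simp only [heq k hk] at h1
      rw [← mul_ite_zero, ← h1, ← sub_zero (∑ χ : DirichletCharacter ℂ N, _ * χ (l : ZMod N)),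
        ← h2, ← Finset.sum_sub_distrib, Finset.mul_sum]
      exact Finset.sum_congr rfl fun χ _ ↦ by ring
    · rw [Finset.sum_ite_eq' S l, if_pos hl]
  rw [hcalc] at hzero
  refine (mul_eq_zero.mp hzero).resolve_right ?_
  exact_mod_cast (Nat.totient_pos.mpr (NeZero.pos N)).ne'

/-- Siegel–Chowla independence (cotangent case): for `N ≥ 3`, the primitive
dual star points `cot(kπ/N) = 1/tan(kπ/N)`, for integers `1 ≤ k < N/2` with
`gcd(k, N) = 1`, are linearly independent over `ℚ`. -/
theorem cot_primitive_star_points_linearIndependent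
    (N : ℕ) (hN : 3 ≤ N) (a : ℕ → ℚ)
    (h : ∑ k ∈ Finset.filter (fun k => 1 ≤ k ∧ 2 * k < N ∧ Nat.gcd k N = 1) (Finset.range N),
        (a k : ℝ) * (Real.tan (k * Real.pi / N))⁻¹ = 0) :
    ∀ k : ℕ, 1 ≤ k → 2 * k < N → Nat.gcd k N = 1 → a k = 0 := by
  have hN0 : 0 < N := by omega
  have : NeZero N := ⟨hN0.ne'⟩
  set S := Finset.filter (fun k => 1 ≤ k ∧ 2 * k < N ∧ Nat.gcd k N = 1) (Finset.range N)
  have hS (k : ℕ) (hk : k ∈ S) : 1 ≤ k ∧ 2 * k < N ∧ k.Coprime N := (Finset.mem_filter.mp hk).2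
  have hψ (k : ℕ) : ZMod.stdAddChar (k : ZMod N) = ZMod.stdAddChar (1 : ZMod N) ^ k := by
    rw [← AddChar.map_nsmul_eq_pow, nsmul_one]
  have hζ : IsPrimitiveRoot (ZMod.stdAddChar (1 : ZMod N)) N := by
    have := ZMod.stdAddChar_coe (N := N) 1
    rw [Int.cast_one, Int.cast_one, mul_one] at this
    exact this ▸ Complex.isPrimitiveRoot_exp N hN0.ne'
  have hζsum : ∑ k ∈ S, (a k : ℂ) * ((ZMod.stdAddChar (1 : ZMod N) ^ k + 1) /
      (1 - ZMod.stdAddChar (1 : ZMod N) ^ k)) = 0 := by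
    have hC := congrArg (fun r : ℝ ↦ Complex.I * (r : ℂ)) h
    simp only [Complex.ofReal_zero, mul_zero] at hC
    rw [← hC, Complex.ofReal_sum, Finset.mul_sum]
    refine Finset.sum_congr rfl fun k hk ↦ ?_
    have hcot := Complex.cot_pi_mul_val_div (k : ZMod N)
    rw [ZMod.val_cast_of_lt (by linarith [(hS k hk).2.1])] at hcot
    have : (((Real.tan (k * Real.pi / N))⁻¹ : ℝ) : ℂ) =
        Complex.cot (Real.pi * (k / N : ℝ)) := by
      rw [Complex.ofReal_inv, Complex.ofReal_tan, Complex.cot, Complex.tan, inv_div]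
      push_cast
      ring_nf
    rw [← hψ, Complex.ofReal_mul, this, hcot, Complex.ofReal_ratCast]
    field_simp
  intro l hl1 hl2 hl3
  have hlS : l ∈ S := Finset.mem_filter.mpr ⟨Finset.mem_range.mpr (by omega), hl1, hl2, hl3⟩
  have hdvd (k : ℕ) (hk : k ∈ S) : ¬ N ∣ k := fun hd ↦ by
    have := Nat.le_of_dvd (hS k hk).1 hd
    have := (hS k hk).2.1
    omega
  have := DirichletCharacter.eq_zero_of_forall_odd_sum_eq_zero hS (a := fun k ↦ (a k : ℂ))
    (fun χ hχ ↦ DirichletCharacter.sum_mul_inv_eq_zero_of_translates hχ.sum_mul_cot_ne_zero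
      (fun k hk ↦ (hS k hk).2.2) fun t ht ↦ ?_) hlS
  · exact_mod_cast this
  · rw [← ZMod.natCast_zmod_val t, ZMod.isUnit_iff_coprime] at ht
    have := hζ.sum_one_add_div_one_sub_pow_eq_zero hN0 hdvd hζsum ht
    simp_rw [Complex.cot_pi_mul_val_div, ← mul_div_assoc, ← Finset.sum_div] at this ⊢
    rw [div_eq_zero_iff]
    left
    rw [← this]
    refine Finset.sum_congr rfl fun k _ ↦ ?_
    have : t * (k : ZMod N) = ((t.val * k : ℕ) : ZMod N) := by simp
    rw [this, hψ, pow_mul]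
end

section
/- Let N ≥ 3 be an integer and let j be an integer with 1 ≤ j < N/2. Then tan(jπ/N) lies in the ℚ-linear span (inside ℝ) of the set {tan(kπ/N) : k an integer with 1 ≤ k < N/2 and gcd(k, N) = 1}. In other words, there exist rational numbers a_k such that tan(jπ/N) = Σ a_k · tan(kπ/N), the sum running over 1 ≤ k < N/2 with gcd(k, N) = 1. -/
open Finset in
/-- Partial fractions over the `n`-th roots of unity, in Cayley-transform form. -/
theorem IsPrimitiveRoot.sum_add_one_div_one_sub {K : Type*} [Field K] {ζ : K} {n : ℕ}
    (hζ : IsPrimitiveRoot ζ n) {u : K} (hu : u ^ n ≠ 1) :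
    ∑ i ∈ range n, (ζ ^ i * u + 1) / (1 - ζ ^ i * u) = n * ((u ^ n + 1) / (1 - u ^ n)) := by
  have hn : 0 < n := Nat.pos_of_ne_zero (by rintro rfl; simp at hu)
  have hu' : 1 - u ^ n ≠ 0 := sub_ne_zero.2 hu.symm
  have hpow (i : ℕ) : (ζ ^ i * u) ^ n = u ^ n := by
    rw [mul_pow, ← pow_mul, mul_comm i, pow_mul, hζ.pow_eq_one, one_pow, one_mul]
  have hne (i : ℕ) : 1 - ζ ^ i * u ≠ 0 := fun h => hu <| by
    rw [← hpow i, ← sub_eq_zero.1 h, one_pow]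
  have hinv : ∑ i ∈ range n, (1 - ζ ^ i * u)⁻¹ = n / (1 - u ^ n) := by
    have hterm (i : ℕ) : (1 - ζ ^ i * u)⁻¹ =
        (1 - u ^ n)⁻¹ * ∑ m ∈ range n, (ζ ^ i * u) ^ m := by
      have := geom_sum_mul_neg (ζ ^ i * u) n
      rw [hpow] at this
      rw [← this]
      rw [← this] at hu'
      have h1 := left_ne_zero_of_mul hu'
      rw [mul_inv, mul_right_comm, inv_mul_cancel₀ h1, one_mul]
    have hsum : ∀ m ∈ range n, m ≠ 0 → ∑ i ∈ range n, (ζ ^ i * u) ^ m = 0 := by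
      intro m hm hm0
      have h1 : ζ ^ m ≠ 1 := fun h =>
        hm0 (Nat.eq_zero_of_dvd_of_lt ((hζ.pow_eq_one_iff_dvd m).1 h) (mem_range.1 hm))
      have h2 : ∑ i ∈ range n, (ζ ^ m) ^ i = 0 := by
        rw [geom_sum_eq h1, ← pow_mul, mul_comm, pow_mul, hζ.pow_eq_one, one_pow, sub_self,
          zero_div]
      simp_rw [mul_pow, ← sum_mul, ← pow_mul, mul_comm _ m, pow_mul, h2, zero_mul]
    simp_rw [hterm, ← mul_sum]
    rw [sum_comm, sum_eq_single_of_mem 0 (mem_range.2 hn) hsum]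
    simp [div_eq_inv_mul]
  have hterm (i : ℕ) : (ζ ^ i * u + 1) / (1 - ζ ^ i * u) = 2 * (1 - ζ ^ i * u)⁻¹ - 1 := by
    have := hne i
    field_simp
    ring
  simp_rw [hterm, sum_sub_distrib, ← mul_sum, hinv]
  simp
  field_simp
  ring

namespace Real

open Finset in
/-- The multiplication formula for the cotangent. -/
theorem sum_cot_add_mul_pi_div {n : ℕ} {x : ℝ} (hx : sin (n * x) ≠ 0) :
    ∑ i ∈ range n, cot (x + i * π / n) = n * cot (n * x) := by
  have hn : n ≠ 0 := by rintro rfl; simp at hx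
  set u := Complex.exp (2 * Complex.I * x) with hu
  have hun : u ^ n = Complex.exp (2 * Complex.I * (n * x)) := by
    rw [hu, ← Complex.exp_nat_mul]
    ring_nf
  have hu1 : u ^ n ≠ 1 := by
    rw [hun, Ne, Complex.exp_eq_one_iff]
    rintro ⟨k, hk⟩
    refine hx (sin_eq_zero_iff.2 ⟨k, ?_⟩)
    have h : (2 * Complex.I) * (n * x) = 2 * Complex.I * (k * π) := by rw [hk]; ring
    have h' := mul_left_cancel₀ (by simp) h
    exact_mod_cast h'.symm
  have key := (Complex.isPrimitiveRoot_exp n hn).sum_add_one_div_one_sub hu1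
  have hexp (i : ℕ) : Complex.exp (2 * Complex.I * (x + i * π / n)) =
      Complex.exp (2 * π * Complex.I / n) ^ i * u := by
    rw [hu, ← Complex.exp_nat_mul, ← Complex.exp_add]
    ring_nf
  apply Complex.ofReal_injective
  push_cast
  simp_rw [Complex.cot_eq_exp_ratio, hexp, ← hun, mul_comm Complex.I, ← div_div, ← sum_div, key]
  ring

theorem cot_add_int_mul_pi (x : ℝ) (n : ℤ) : cot (x + n * π) = cot x := by
  rw [← tan_inv_eq_cot, ← tan_inv_eq_cot, tan_add_int_mul_pi]

/-- Also valid at the poles, where both sides vanish. -/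
theorem tan_eq_cot_sub_two_mul_cot_two_mul (x : ℝ) : tan x = cot x - 2 * cot (2 * x) := by
  rw [tan_eq_sin_div_cos, cot_eq_cos_div_sin, cot_eq_cos_div_sin, sin_two_mul, cos_two_mul']
  by_cases hs : sin x = 0
  · simp [hs]
  by_cases hc : cos x = 0
  · simp [hc]
  field_simp
  ring

end Real

/-- A periodic sequence satisfying `f k ≡ q f (q k)` modulo `V` has its values in `V`. -/
theorem mem_of_sub_mul_mem {V : Submodule ℚ ℝ} {M q : ℕ} (hq : 2 ≤ q) (hqM : q.Coprime M)
    {f : ℤ → ℝ} (hper : ∀ k n : ℤ, f (k + n * M) = f k)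
    (hf : ∀ k : ℤ, IsCoprime k M → f k - q * f (q * k) ∈ V) {k : ℤ} (hk : IsCoprime k M) :
    f k ∈ V := by
  have hqM' : IsCoprime (q : ℤ) M := Nat.isCoprime_iff_coprime.2 hqM
  have hsmul (a : ℕ) (y : ℝ) (hy : y ∈ V) : (a : ℝ) * y ∈ V := by
    rw [← nsmul_eq_mul]
    exact V.nsmul_mem hy a
  have hiter (n : ℕ) : f k - (q : ℝ) ^ n * f ((q : ℤ) ^ n * k) ∈ V := by
    induction n with
    | zero => simp
    | succ n ih =>
      have h := V.add_mem ih (hsmul (q ^ n) _ (hf _ ((hqM'.pow_left (m := n)).mul_left hk)))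
      convert h using 1
      rw [← mul_assoc (q : ℤ), ← pow_succ']
      push_cast
      ring
  by_cases hM : M = 0
  · subst hM
    rw [Nat.coprime_zero_right] at hqM
    omega
  obtain ⟨d, hd⟩ : (M : ℤ) ∣ (q : ℤ) ^ M.totient - 1 := by
    have h := (Nat.ModEq.pow_totient hqM).symm
    rw [Nat.modEq_iff_dvd] at h
    exact_mod_cast h
  have hfix : f ((q : ℤ) ^ M.totient * k) = f k := by
    rw [← hper k (d * k)]
    congr 1
    linear_combination k * hd
  have h := hiter M.totient
  rw [hfix] at h
  have hlt : (1 : ℚ) < (q : ℚ) ^ M.totient :=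
    one_lt_pow₀ (by exact_mod_cast hq) (Nat.totient_pos.2 (Nat.pos_of_ne_zero hM)).ne'
  have hne : (1 : ℚ) - (q : ℚ) ^ M.totient ≠ 0 := (sub_neg.2 hlt).ne
  refine (V.smul_mem_iff hne).1 ?_
  convert h using 1
  rw [Rat.smul_def]
  push_cast
  ring

/-- The `ℚ`-span of the numbers `cot (kπ/N)` with `k` coprime to `N`. -/
noncomputable def cotSpan (N : ℕ) : Submodule ℚ ℝ :=
  Submodule.span ℚ {x : ℝ | ∃ k : ℤ, IsCoprime k N ∧ x = Real.cot (k * Real.pi / N)}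

theorem cot_mem_cotSpan {N : ℕ} {k : ℤ} (hk : IsCoprime k N) :
    Real.cot (k * Real.pi / N) ∈ cotSpan N :=
  Submodule.subset_span ⟨k, hk, rfl⟩

theorem cot_add_mul_mul_pi_div {N : ℕ} (hN : N ≠ 0) (k n : ℤ) :
    Real.cot ((k + n * N : ℤ) * Real.pi / N) = Real.cot (k * Real.pi / N) := by
  rw [← Real.cot_add_int_mul_pi (k * Real.pi / N) n]
  congr 1
  have : (N : ℝ) ≠ 0 := Nat.cast_ne_zero.2 hN
  push_cast
  field_simp

theorem natCast_mul_cot_eq_sum {M p : ℕ} (hM : 1 < M) (hp : p ≠ 0) {k : ℤ}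
    (hk : IsCoprime k M) :
    p * Real.cot (k * Real.pi / M) =
      ∑ i ∈ Finset.range p, Real.cot ((k + i * M : ℤ) * Real.pi / (p * M : ℕ)) := by
  have hM' : (M : ℝ) ≠ 0 := Nat.cast_ne_zero.2 (by omega)
  have hp' : (p : ℝ) ≠ 0 := Nat.cast_ne_zero.2 hp
  have hx : (p : ℝ) * (k * Real.pi / (p * M)) = k * Real.pi / M := by field_simp
  have hsin : Real.sin (p * (k * Real.pi / (p * M))) ≠ 0 := by
    rw [hx, Ne, Real.sin_eq_zero_iff]
    rintro ⟨n, hn⟩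
    have hdvd : (k : ℝ) = M * n := by
      field_simp at hn
      linarith
    have hdvd' : (M : ℤ) ∣ k := ⟨n, by exact_mod_cast hdvd⟩
    have := Int.isUnit_iff.1 (hk.symm.isUnit_of_dvd' dvd_rfl hdvd')
    omega
  rw [← hx, ← Real.sum_cot_add_mul_pi_div hsin]
  refine Finset.sum_congr rfl fun i _ => ?_
  congr 1
  push_cast
  field_simp

theorem cotSpan_le_prime_mul {M p : ℕ} (hM : M ≠ 0) (hp : p.Prime) :
    cotSpan M ≤ cotSpan (p * M) := by
  refine Submodule.span_le.2 ?_
  rintro _ ⟨k, hk, rfl⟩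
  obtain rfl | hM1 : M = 1 ∨ 1 < M := by omega
  · have : Real.cot (k * Real.pi / (1 : ℕ)) = 0 := by
      rw [Real.cot_eq_cos_div_sin]
      simp [Real.sin_int_mul_pi]
    rw [this]
    exact Submodule.zero_mem _
  by_cases hpM : p ∣ M
  · refine ((cotSpan (p * M)).smul_mem_iff (Nat.cast_ne_zero.2 hp.ne_zero : (p : ℚ) ≠ 0)).1 ?_
    rw [Rat.smul_def, Rat.cast_natCast, natCast_mul_cot_eq_sum hM1 hp.ne_zero hk]
    refine Submodule.sum_mem _ fun i _ => cot_mem_cotSpan ?_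
    have h : IsCoprime (k + i * M) M := hk.add_mul_right_left i
    push_cast
    exact (h.of_isCoprime_of_dvd_right (Int.natCast_dvd_natCast.2 hpM)).mul_right h
  · have hcop : p.Coprime M := (Nat.Prime.coprime_iff_not_dvd hp).2 hpM
    have hcop' : IsCoprime (p : ℤ) M := Nat.isCoprime_iff_coprime.2 hcop
    refine mem_of_sub_mul_mem hp.two_le hcop
      (f := fun k => Real.cot (k * Real.pi / M)) (cot_add_mul_mul_pi_div hM) (fun l hl => ?_) hk
    rw [natCast_mul_cot_eq_sum hM1 hp.ne_zero (hcop'.mul_left hl), ← Finset.sum_erase_add _ _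
      (Finset.mem_range.2 hp.pos)]
    have hzero : Real.cot (((p * l + (0 : ℕ) * M : ℤ) : ℝ) * Real.pi / (p * M : ℕ)) =
        Real.cot (l * Real.pi / M) := by
      have hp' : (p : ℝ) ≠ 0 := Nat.cast_ne_zero.2 hp.ne_zero
      congr 1
      push_cast
      field_simp
      ring
    rw [hzero, sub_add_cancel_right]
    refine Submodule.neg_mem _ (Submodule.sum_mem _ fun i hi => cot_mem_cotSpan ?_)
    obtain ⟨hi0, hip⟩ := Finset.mem_erase.1 hi
    have hicop : IsCoprime (i : ℤ) p := by
      rw [Nat.isCoprime_iff_coprime]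
      exact (Nat.coprime_of_lt_prime hi0 (Finset.mem_range.1 hip) hp).symm
    push_cast
    refine IsCoprime.mul_right ?_ ((hcop'.mul_left hl).add_mul_right_left i)
    rw [add_comm]
    exact (hicop.mul_left hcop'.symm).add_mul_left_left l

theorem cotSpan_le_mul {M d : ℕ} (hM : M ≠ 0) (hd : d ≠ 0) : cotSpan M ≤ cotSpan (d * M) := by
  induction d using induction_on_primes with
  | zero => exact absurd rfl hd
  | one => rw [one_mul]
  | prime_mul p a hp ih =>
    have ha : a ≠ 0 := right_ne_zero_of_mul hd
    rw [mul_assoc]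
    exact (ih ha).trans (cotSpan_le_prime_mul (mul_ne_zero ha hM) hp)

/-- The primitive cotangents span all cotangents with the same denominator. -/
theorem cot_int_mul_pi_div_mem_cotSpan {N : ℕ} (hN : N ≠ 0) (j : ℤ) :
    Real.cot (j * Real.pi / N) ∈ cotSpan N := by
  have hg : 0 < Int.gcd j N := Int.gcd_pos_of_ne_zero_right _ (by exact_mod_cast hN)
  obtain ⟨a, ha⟩ := Int.gcd_dvd_left j N
  obtain ⟨M, hM⟩ : Int.gcd j N ∣ N := Int.natCast_dvd_natCast.1 (Int.gcd_dvd_right j N)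
  generalize hgd : Int.gcd j N = g at *
  have hM0 : M ≠ 0 := by rintro rfl; simp at hM; exact hN hM
  have hcop : IsCoprime a (M : ℤ) := by
    rw [Int.isCoprime_iff_gcd_eq_one]
    rw [ha, hM, Nat.cast_mul, Int.gcd_mul_left, Int.natAbs_natCast] at hgd
    exact Nat.eq_of_mul_eq_mul_left hg (by rw [hgd, mul_one])
  have h := cotSpan_le_mul hM0 hg.ne' (cot_mem_cotSpan hcop)
  rw [← hM] at h
  convert h using 2
  have hg' : (g : ℝ) ≠ 0 := Nat.cast_ne_zero.2 hg.ne'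
  rw [ha, hM]
  push_cast
  field_simp

/-- A submodule containing the star points `tan (kπ/N)` with `1 ≤ k < N/2` coprime to `N`
contains `tan (kπ/N)` for every integer `k` coprime to `N`. -/
theorem tan_int_mul_pi_div_mem {N : ℕ} (hN : 3 ≤ N) {V : Submodule ℚ ℝ}
    (hV : ∀ k : ℕ, 1 ≤ k → 2 * k < N → Nat.gcd k N = 1 → Real.tan (k * Real.pi / N) ∈ V)
    {k : ℤ} (hk : IsCoprime k N) : Real.tan (k * Real.pi / N) ∈ V := by
  have hN' : (N : ℝ) ≠ 0 := Nat.cast_ne_zero.2 (by omega)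
  have hNz : (N : ℤ) ≠ 0 := by omega
  have hdiv := Int.emod_add_mul_ediv k N
  have hr0 := Int.emod_nonneg k hNz
  have hrN := Int.emod_lt_of_pos k (by omega : (0 : ℤ) < N)
  have hrcop : IsCoprime (k % N) (N : ℤ) := by
    rw [← hdiv] at hk
    exact hk.of_add_mul_left_left
  have htan : Real.tan (k * Real.pi / N) = Real.tan ((k % N : ℤ) * Real.pi / N) := by
    rw [← Real.tan_add_int_mul_pi ((k % N : ℤ) * Real.pi / N) (k / N)]
    congr 1
    have : (k : ℝ) = (k % N : ℤ) + N * (k / N : ℤ) := by exact_mod_cast hdiv.symm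
    rw [this]
    field_simp
  rw [htan]
  generalize k % (N : ℤ) = r at *
  lift r to ℕ using hr0
  have hgcd : Nat.Coprime r N := Nat.isCoprime_iff_coprime.1 hrcop
  have hrpos : r ≠ 0 := by
    rintro rfl
    rw [Nat.coprime_zero_left] at hgcd
    omega
  rcases lt_trichotomy (2 * r) N with h | h | h
  · exact_mod_cast hV r (by omega) h hgcd
  · have := Nat.Coprime.eq_one_of_dvd hgcd ⟨2, by omega⟩
    omega
  · have hmem := V.neg_mem (hV (N - r) (by omega) (by omega)
      ((Nat.coprime_self_sub_left (by omega)).2 hgcd))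
    convert hmem using 1
    rw [Nat.cast_sub (by omega), ← Real.tan_pi_sub]
    congr 1
    push_cast
    field_simp
    ring

/-- If the `tan (kπ/N)` with `k` coprime to `N` lie in `V`, then so do all `tan (jπ/N)`. -/
theorem tan_int_mul_pi_div_mem_of_forall_isCoprime {N : ℕ} (hN : N ≠ 0) {V : Submodule ℚ ℝ}
    (hV : ∀ k : ℤ, IsCoprime k N → Real.tan (k * Real.pi / N) ∈ V) (j : ℤ) :
    Real.tan (j * Real.pi / N) ∈ V := by
  have hdouble {M : ℕ} (hM : M ≠ 0) (hle : cotSpan M ≤ V) (i : ℤ) :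
      Real.tan (i * Real.pi / M) ∈ V := by
    rw [Real.tan_eq_cot_sub_two_mul_cot_two_mul]
    refine V.sub_mem (hle (cot_int_mul_pi_div_mem_cotSpan hM i)) ?_
    have h := V.smul_mem (2 : ℚ) (hle (cot_int_mul_pi_div_mem_cotSpan hM (2 * i)))
    convert h using 1
    rw [Rat.smul_def]
    push_cast
    ring_nf
  have hreflect {M : ℕ} (hM : M ≠ 0) (i : ℤ) :
      Real.cot (i * Real.pi / (2 * M : ℕ)) =
        Real.tan ((M - i : ℤ) * Real.pi / (2 * M : ℕ)) := by
    have hM' : (M : ℝ) ≠ 0 := Nat.cast_ne_zero.2 hM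
    rw [← Real.tan_inv_eq_cot, ← Real.tan_pi_div_two_sub]
    congr 1
    push_cast
    field_simp
  rcases Nat.even_or_odd' N with ⟨M, rfl | hodd⟩
  · have hM : M ≠ 0 := by omega
    rcases Nat.even_or_odd M with hM2 | hM2
    · refine hdouble hN (Submodule.span_le.2 ?_) j
      rintro _ ⟨k, hk, rfl⟩
      rw [hreflect hM]
      refine hV _ ?_
      push_cast at hk ⊢
      have hkM : IsCoprime (M - k : ℤ) M := by
        rw [show (M - k : ℤ) = -k + M * 1 by ring]
        exact hk.of_mul_right_right.neg_left.add_mul_left_left 1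
      exact (hkM.of_isCoprime_of_dvd_right (by exact_mod_cast hM2.two_dvd)).mul_right hkM
    · have hle : cotSpan M ≤ V := by
        refine Submodule.span_le.2 ?_
        rintro _ ⟨k, hk, rfl⟩
        have hcast : (k : ℝ) * Real.pi / M = (2 * k : ℤ) * Real.pi / (2 * M : ℕ) := by
          push_cast
          field_simp
        rw [hcast, hreflect hM]
        refine hV _ ?_
        have h2M : IsCoprime (M : ℤ) 2 := by
          exact_mod_cast Nat.isCoprime_iff_coprime.2 hM2.coprime_two_right
        push_cast
        refine IsCoprime.mul_right ?_ ?_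
        · rw [show (M - 2 * k : ℤ) = M + 2 * -k by ring]
          exact h2M.add_mul_left_left (-k)
        · rw [show (M - 2 * k : ℤ) = -(2 * k) + M * 1 by ring]
          exact (h2M.symm.mul_left hk).neg_left.add_mul_left_left 1
      rcases Int.even_or_odd' j with ⟨i, rfl | rfl⟩
      · convert hdouble hM hle i using 2
        push_cast
        field_simp
      · obtain ⟨m, hm⟩ := hM2
        convert hle (cot_int_mul_pi_div_mem_cotSpan hM (m - i)) using 1
        have hcast : ((m - i : ℤ) : ℝ) * Real.pi / M =
            (2 * (m - i) : ℤ) * Real.pi / (2 * M : ℕ) := by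
          push_cast
          field_simp
        rw [hcast, hreflect hM]
        congr 4
        omega
  · refine hdouble hN (Submodule.span_le.2 ?_) j
    rintro _ ⟨k, hk, rfl⟩
    have hcop : Nat.Coprime 2 N := Odd.coprime_two_left ⟨M, hodd⟩
    refine mem_of_sub_mul_mem le_rfl hcop
      (f := fun k => Real.cot (k * Real.pi / N)) (cot_add_mul_mul_pi_div hN) (fun l hl => ?_) hk
    convert hV l hl using 1
    rw [Real.tan_eq_cot_sub_two_mul_cot_two_mul]
    push_cast
    ring_nf

/-- Basis Lemma (star points): for `N ≥ 3` and an integer `1 ≤ j < N/2`, the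
star point `tan(jπ/N)` lies in the `ℚ`-linear span of the primitive star
points `tan(kπ/N)` with `1 ≤ k < N/2` and `gcd(k, N) = 1`. -/
theorem tan_mem_span_primitive_star_points
    (N : ℕ) (hN : 3 ≤ N) (j : ℕ) (hj1 : 1 ≤ j) (hj2 : 2 * j < N) :
    Real.tan (j * Real.pi / N) ∈
      Submodule.span ℚ
        {x : ℝ | ∃ k : ℕ, 1 ≤ k ∧ 2 * k < N ∧ Nat.gcd k N = 1 ∧
          x = Real.tan (k * Real.pi / N)} := by
  have hprim (k : ℤ) (hk : IsCoprime k N) := tan_int_mul_pi_div_mem hN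
    (V := Submodule.span ℚ {x : ℝ | ∃ k : ℕ, 1 ≤ k ∧ 2 * k < N ∧ Nat.gcd k N = 1 ∧
      x = Real.tan (k * Real.pi / N)})
    (fun k h1 h2 h3 => Submodule.subset_span ⟨k, h1, h2, h3, rfl⟩) hk
  exact_mod_cast tan_int_mul_pi_div_mem_of_forall_isCoprime (by omega) hprim j
end

section
/- Let N ≥ 3 be an integer and let k be an integer with 1 ≤ k < N/2 and gcd(k, N) = 1. Then the real number tan(π/N)/tan(kπ/N) is an algebraic unit: both tan(π/N)/tan(kπ/N) and its reciprocal tan(kπ/N)/tan(π/N) are algebraic integers, i.e., integral over ℤ. -/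
theorem isIntegral_pow_sub_one_div_sub_one {z : ℂ} (hz : IsIntegral ℤ z) (k : ℕ) :
    IsIntegral ℤ ((z ^ k - 1) / (z - 1)) := by
  rcases eq_or_ne z 1 with rfl | h
  · simpa using isIntegral_zero
  · rw [← geom_sum_eq h]
    exact IsIntegral.sum _ fun i _ => hz.pow i

theorem isIntegral_pow_add_one_div_add_one {w : ℂ} (hw : IsIntegral ℤ w) {m : ℕ} (hm : Odd m) :
    IsIntegral ℤ ((w ^ m + 1) / (w + 1)) := by
  have h := isIntegral_pow_sub_one_div_sub_one hw.neg m
  rwa [hm.neg_pow, ← neg_add', ← neg_add', neg_div_neg_eq] at h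

theorem Complex.tan_eq_exp_two_mul (x : ℂ) :
    Complex.tan x = -I * ((exp (2 * x * I) - 1) / (exp (2 * x * I) + 1)) := by
  have h2 : exp (2 * x * I) = exp (x * I) ^ 2 := by
    rw [← exp_nat_mul]
    push_cast
    ring_nf
  have hs : sin x = -I * (exp (2 * x * I) - 1) / (2 * exp (x * I)) := by
    rw [sin, neg_mul, exp_neg, h2]
    field_simp
    ring
  have hc : cos x = (exp (2 * x * I) + 1) / (2 * exp (x * I)) := by
    rw [cos, neg_mul, exp_neg, h2]
    field_simp
  rw [tan, hs, hc, div_div_div_cancel_right₀ (by simp), mul_div_assoc]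

/-- If `exp (2iy)` is a power of `exp (2ix)`, and conversely with an odd exponent, then
`tan y / tan x` is an algebraic integer. -/
theorem isIntegral_tan_div_tan {x y : ℝ} {k m : ℕ} (hm : Odd m)
    (hx : IsIntegral ℤ (Complex.exp (2 * x * Complex.I)))
    (hk : Complex.exp (2 * x * Complex.I) ^ k = Complex.exp (2 * y * Complex.I))
    (hmk : Complex.exp (2 * y * Complex.I) ^ m = Complex.exp (2 * x * Complex.I)) :
    IsIntegral ℤ (Real.tan y / Real.tan x) := by
  rw [← isIntegral_algebraMap_iff (algebraMap ℝ ℂ).injective (B := ℂ)]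
  have hy : IsIntegral ℤ (Complex.exp (2 * y * Complex.I)) := hk ▸ hx.pow k
  have h := (isIntegral_pow_sub_one_div_sub_one hx k).mul
    (isIntegral_pow_add_one_div_add_one hy hm)
  rw [hk, hmk] at h
  have heq : algebraMap ℝ ℂ (Real.tan y / Real.tan x) =
      (Complex.exp (2 * y * Complex.I) - 1) / (Complex.exp (2 * x * Complex.I) - 1) *
        ((Complex.exp (2 * x * Complex.I) + 1) / (Complex.exp (2 * y * Complex.I) + 1)) := by
    rw [Complex.coe_algebraMap, Complex.ofReal_div, Complex.ofReal_tan, Complex.ofReal_tan,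
      Complex.tan_eq_exp_two_mul, Complex.tan_eq_exp_two_mul,
      mul_div_mul_left _ _ (neg_ne_zero.mpr Complex.I_ne_zero), div_div_div_eq, div_mul_div_comm,
      mul_comm (Complex.exp (2 * y * Complex.I) + 1)]
  rw [heq]
  exact h

theorem Nat.Coprime.exists_odd_modEq {k N : ℕ} (h : Nat.Coprime k N) :
    ∃ l, Odd l ∧ l ≡ k [MOD N] := by
  rcases Nat.even_or_odd k with hk | hk
  · refine ⟨k + N, hk.add_odd ?_, by simp [Nat.ModEq]⟩
    exact Nat.Coprime.odd_of_left (h.coprime_dvd_left hk.two_dvd)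
  · exact ⟨k, hk, rfl⟩

/-- For `N ≥ 3` and an integer `1 ≤ k < N/2` with `gcd(k, N) = 1`, the
primitive scale `tan(π/N)/tan(kπ/N)` is an algebraic unit: both it and its
reciprocal `tan(kπ/N)/tan(π/N)` are integral over `ℤ`. -/
theorem primitive_scale_isAlgebraicUnit
    (N : ℕ) (hN : 3 ≤ N) (k : ℕ) (hk1 : 1 ≤ k) (hk2 : 2 * k < N)
    (hk3 : Nat.gcd k N = 1) :
    IsIntegral ℤ (Real.tan (Real.pi / N) / Real.tan (k * Real.pi / N)) ∧
    IsIntegral ℤ (Real.tan (k * Real.pi / N) / Real.tan (Real.pi / N)) := by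
  have hN0 : N ≠ 0 := by omega
  have hprim : IsPrimitiveRoot (Complex.exp (2 * (Real.pi / N : ℝ) * Complex.I)) N := by
    convert Complex.isPrimitiveRoot_exp N hN0 using 2
    push_cast
    ring
  have hpow : Complex.exp (2 * (k * Real.pi / N : ℝ) * Complex.I) =
      Complex.exp (2 * (Real.pi / N : ℝ) * Complex.I) ^ k := by
    rw [← Complex.exp_nat_mul]
    push_cast
    ring_nf
  have hpow_congr {a b : ℕ} (h : a ≡ b [MOD N]) :
      Complex.exp (2 * (Real.pi / N : ℝ) * Complex.I) ^ a =
        Complex.exp (2 * (Real.pi / N : ℝ) * Complex.I) ^ b := by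
    rw [pow_eq_pow_mod a hprim.pow_eq_one, h, ← pow_eq_pow_mod b hprim.pow_eq_one]
  obtain ⟨l, hl, hlk⟩ := Nat.Coprime.exists_odd_modEq hk3
  obtain ⟨j, -, hj⟩ := Nat.exists_mul_mod_eq_one_of_coprime hk3 (by omega)
  have hkj : k * j ≡ 1 [MOD N] := by rw [Nat.ModEq, hj, Nat.mod_eq_of_lt (by omega)]
  obtain ⟨m, hm, hmj⟩ := Nat.Coprime.exists_odd_modEq
    (Nat.coprime_of_mul_modEq_one k (by rwa [mul_comm] at hkj) : Nat.Coprime j N)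
  have hkm : k * m ≡ 1 [MOD N] := (hmj.mul_left k).trans hkj
  have hl_pow := (hpow_congr hlk).trans hpow.symm
  have hm_pow : Complex.exp (2 * (k * Real.pi / N : ℝ) * Complex.I) ^ m =
      Complex.exp (2 * (Real.pi / N : ℝ) * Complex.I) := by
    rw [hpow, ← pow_mul, hpow_congr hkm, pow_one]
  have hint := hprim.isIntegral (by omega)
  exact ⟨isIntegral_tan_div_tan hl (hpow ▸ hint.pow k) hm_pow hl_pow,
    isIntegral_tan_div_tan hm hint hl_pow hm_pow⟩
end

section
/- Let N ≥ 3 be an integer. If N is divisible by 4, then tan(π/N)² is an algebraic unit, i.e., both tan(π/N)² and its reciprocal are algebraic integers. If N is odd, then tan(π/N)·tan(π/(2N)) is an algebraic unit, i.e., both it and its reciprocal are algebraic integers. -/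
theorem IsIntegral.pow_sub_one_div_sub_one {R K : Type*} [CommRing R] [Field K] [Algebra R K]
    {x : K} (hx : IsIntegral R x) (n : ℕ) : IsIntegral R ((x ^ n - 1) / (x - 1)) := by
  by_cases h : x = 1
  · simpa [h] using isIntegral_zero
  · rw [← geom_sum_eq h]
    exact IsIntegral.sum _ fun i _ => hx.pow i

theorem isIntegral_ofReal_iff {x : ℝ} : IsIntegral ℤ (x : ℂ) ↔ IsIntegral ℤ x :=
  isIntegral_algebraMap_iff (algebraMap ℝ ℂ).injective

/-- If `-1` is an even power of `w`, then `(w - 1) / (w + 1)` and its inverse are integral. -/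
theorem isIntegral_sub_one_div_add_one {K : Type*} [Field K] {w : K} {m : ℕ}
    (hm : m ≠ 0) (hw : w ^ (2 * m) = -1) :
    IsIntegral ℤ ((w - 1) / (w + 1)) ∧ IsIntegral ℤ ((w - 1) / (w + 1))⁻¹ := by
  have hint : IsIntegral ℤ w :=
    IsIntegral.of_pow (n := 2 * m) (by omega) (hw ▸ isIntegral_one.neg)
  have h1 : w ^ (2 * m + 1) = -w := by rw [pow_succ, hw]; ring
  have h2 : (-w) ^ (2 * m + 1) = w := by rw [Odd.neg_pow ⟨m, rfl⟩, h1, neg_neg]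
  constructor
  · have := (hint.neg.pow_sub_one_div_sub_one (2 * m + 1)).neg
    rwa [h2, ← neg_add', div_neg, neg_neg] at this
  · have := (hint.pow_sub_one_div_sub_one (2 * m + 1)).neg
    rwa [h1, ← neg_add', neg_div, neg_neg, ← inv_div] at this

/-- If `v` has odd order and `v ≠ 1`, then `v + 1` is a unit among the integral elements. -/
theorem isIntegral_inv_add_one {K : Type*} [Field K] {v : K} {k : ℕ}
    (hv : v ^ (2 * k + 1) = 1) (h1 : v ≠ 1) : IsIntegral ℤ (v + 1)⁻¹ := by
  have hint : IsIntegral ℤ v := IsIntegral.of_pow (Nat.succ_pos _) (hv ▸ isIntegral_one)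
  have := (hint.pow 2).pow_sub_one_div_sub_one (k + 1)
  have h2 : (v ^ 2) ^ (k + 1) = v := by
    rw [← pow_mul, show 2 * (k + 1) = 2 * k + 1 + 1 by ring, pow_succ, hv, one_mul]
  rwa [h2, show v ^ 2 - 1 = (v - 1) * (v + 1) by ring, div_mul_cancel_left₀ (sub_ne_zero.2 h1)]
    at this

theorem isIntegral_tan_sq_of_four_dvd {N : ℕ} (hN : N ≠ 0) (h4 : 4 ∣ N) :
    IsIntegral ℤ (Real.tan (Real.pi / N) ^ 2) ∧
      IsIntegral ℤ (Real.tan (Real.pi / N) ^ 2)⁻¹ := by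
  obtain ⟨m, rfl⟩ := h4
  have hm : (m : ℂ) ≠ 0 := by
    rintro h; simp_all
  rw [← isIntegral_ofReal_iff, ← isIntegral_ofReal_iff]
  push_cast
  rw [Complex.tan_eq_exp_two_mul]
  set w := Complex.exp (2 * (Real.pi / (4 * m)) * Complex.I) with hw
  have hwm : w ^ (2 * m) = -1 := by
    rw [hw, ← Complex.exp_nat_mul, ← Complex.exp_pi_mul_I]
    congr 1; push_cast; field_simp; norm_num
  obtain ⟨h, h'⟩ := isIntegral_sub_one_div_add_one (by omega) hwm
  rw [mul_pow, neg_sq, Complex.I_sq, neg_one_mul, inv_neg, ← inv_pow]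
  exact ⟨(h.pow 2).neg, (h'.pow 2).neg⟩

theorem isIntegral_tan_mul_tan_half_of_odd {N : ℕ} (hN : 1 < N) (hodd : Odd N) :
    IsIntegral ℤ (Real.tan (Real.pi / N) * Real.tan (Real.pi / (2 * N))) ∧
      IsIntegral ℤ (Real.tan (Real.pi / N) * Real.tan (Real.pi / (2 * N)))⁻¹ := by
  have hN0 : (N : ℂ) ≠ 0 := by exact_mod_cast (by omega : N ≠ 0)
  rw [← isIntegral_ofReal_iff, ← isIntegral_ofReal_iff]
  push_cast
  rw [Complex.tan_eq_exp_two_mul, Complex.tan_eq_exp_two_mul]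
  obtain ⟨v, hv⟩ : ∃ v, v = -Complex.exp (2 * (Real.pi / (2 * N)) * Complex.I) := ⟨_, rfl⟩
  have hw : Complex.exp (2 * (Real.pi / (2 * N)) * Complex.I) = -v := by rw [hv, neg_neg]
  have hw2 : Complex.exp (2 * (Real.pi / N) * Complex.I) = v ^ 2 := by
    rw [hv, neg_sq, ← Complex.exp_nat_mul]
    congr 1; push_cast; field_simp
  have hv2 : v ^ 2 ≠ 1 := by
    rw [← hw2, ← mul_div_assoc, div_mul_eq_mul_div]
    exact (Complex.isPrimitiveRoot_exp N (by omega)).ne_one hN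
  have hvN : v ^ N = 1 := by
    rw [hv, hodd.neg_pow, ← Complex.exp_nat_mul, neg_eq_iff_eq_neg, ← Complex.exp_pi_mul_I]
    congr 1; field_simp
  have hv1 : v ≠ 1 := fun h => hv2 (by rw [h, one_pow])
  have hint : IsIntegral ℤ v := IsIntegral.of_pow (by omega) (hvN ▸ isIntegral_one)
  rw [hw, hw2]
  obtain ⟨k, rfl⟩ := hodd
  have hprod : -Complex.I * ((v ^ 2 - 1) / (v ^ 2 + 1)) * (-Complex.I * ((-v - 1) / (-v + 1)))
      = -((v + 1) ^ 2 * (v ^ 2 + 1)⁻¹) := by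
    have h : -v + 1 ≠ 0 := fun h => hv1 (by linear_combination -h)
    have hsplit : (v ^ 2 - 1) * (-v - 1) = (v + 1) ^ 2 * (-v + 1) := by ring
    rw [mul_mul_mul_comm, div_mul_div_comm, hsplit, mul_div_mul_right _ _ h, neg_mul_neg,
      Complex.I_mul_I, neg_one_mul, div_eq_mul_inv]
  rw [hprod, inv_neg, mul_inv, inv_inv, ← inv_pow]
  have hunit := isIntegral_inv_add_one hvN hv1
  have hunit2 := isIntegral_inv_add_one (v := v ^ 2) (k := k)
    (by rw [← pow_mul, mul_comm, pow_mul, hvN, one_pow]) hv2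
  exact ⟨(((hint.add isIntegral_one).pow 2).mul hunit2).neg,
    ((hunit.pow 2).mul ((hint.pow 2).add isIntegral_one)).neg⟩

/-- For `N ≥ 3`: if `4 ∣ N` then `tan²(π/N)` is an algebraic unit (it and its
reciprocal are integral over `ℤ`), and if `N` is odd then
`tan(π/N)·tan(π/(2N))` is an algebraic unit. -/
theorem genScale_isAlgebraicUnit (N : ℕ) (hN : 3 ≤ N) :
    (4 ∣ N →
      IsIntegral ℤ (Real.tan (Real.pi / N) ^ 2) ∧
      IsIntegral ℤ (Real.tan (Real.pi / N) ^ 2)⁻¹) ∧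
    (Odd N →
      IsIntegral ℤ (Real.tan (Real.pi / N) * Real.tan (Real.pi / (2 * N))) ∧
      IsIntegral ℤ (Real.tan (Real.pi / N) * Real.tan (Real.pi / (2 * N)))⁻¹) := by
  exact ⟨isIntegral_tan_sq_of_four_dvd (by omega),
    isIntegral_tan_mul_tan_half_of_odd (by omega)⟩
end

section
/- Let n > 2 be an integer with n ≠ 4, and let k be an integer with gcd(k, n) = 1. Then the degree of sin(2kπ/n) over ℚ (the degree of its minimal polynomial over ℚ) equals: φ(n) if 4 does not divide n; φ(n)/2 if n ≡ 0 (mod 8); and φ(n)/4 if n ≡ 4 (mod 8). Here φ is the Euler totient function. -/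
open IntermediateField in
/-- If `exp (θ * I)` is a primitive `N`-th root of unity with `N > 2`, then `cos θ` has degree
`φ N / 2` over `ℚ`. -/
theorem natDegree_minpoly_cos_of_isPrimitiveRoot {N : ℕ} (hN : 2 < N) {θ : ℝ}
    (h : IsPrimitiveRoot (Complex.exp (θ * Complex.I)) N) :
    (minpoly ℚ (Real.cos θ)).natDegree = N.totient / 2 := by
  set ζ : ℂ := Complex.exp (θ * Complex.I) with hζ
  set c : ℂ := (Real.cos θ : ℂ) with hc
  have hζ0 : ζ ≠ 0 := Complex.exp_ne_zero _
  have hcζ : 2 * c = ζ + ζ⁻¹ := by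
    rw [hc, Complex.ofReal_cos, Complex.two_cos, hζ, ← Complex.exp_neg, neg_mul]
  have hquad : ζ ^ 2 - 2 * c * ζ + 1 = 0 := by
    rw [hcζ]
    field_simp
    ring
  have hζint : IsIntegral ℚ ζ := (h.isIntegral (by omega)).tower_top
  have hcmem : c ∈ ℚ⟮ζ⟯ := by
    have hmem : (ζ + ζ⁻¹) / 2 ∈ ℚ⟮ζ⟯ :=
      div_mem (add_mem (mem_adjoin_simple_self ℚ ζ) (inv_mem (mem_adjoin_simple_self ℚ ζ)))
        (ofNat_mem _ 2)
    rwa [← hcζ, mul_div_cancel_left₀ _ two_ne_zero] at hmem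
  have hcint : IsIntegral ℚ c := by
    have : FiniteDimensional ℚ ℚ⟮ζ⟯ := adjoin.finiteDimensional hζint
    exact (IsIntegral.of_finite ℚ (⟨c, hcmem⟩ : ℚ⟮ζ⟯)).map ℚ⟮ζ⟯.val
  have hζim : ζ.im ≠ 0 := by
    intro him
    have hreal : ((ζ.re : ℝ) : ℂ) = ζ := Complex.ext rfl (by simp [him])
    have hsq : ζ ^ 2 = 1 := by
      have hnorm : ‖ζ‖ = 1 := Complex.norm_exp_ofReal_mul_I θ
      rw [← hreal, Complex.norm_real, Real.norm_eq_abs] at hnorm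
      rw [← hreal, ← Complex.ofReal_pow, ← sq_abs, hnorm]
      simp
    exact absurd (Nat.le_of_dvd two_pos (h.dvd_of_pow_eq_one 2 hsq)) (by omega)
  have hζnot : ζ ∉ ℚ⟮c⟯ := by
    intro hmem
    have hle : ℚ⟮c⟯ ≤ (Complex.ofRealAm.restrictScalars ℚ).fieldRange :=
      adjoin_simple_le_iff.2 ⟨Real.cos θ, rfl⟩
    obtain ⟨r, hr⟩ := hle hmem
    apply hζim
    rw [← hr]
    exact Complex.ofReal_im r
  have hdeg : (minpoly ℚ⟮c⟯ ζ).natDegree = 2 := by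
    refine le_antisymm ?_ ((minpoly.two_le_natDegree_iff hζint.tower_top).2 ?_)
    · let p : Polynomial ℚ⟮c⟯ := .C 1 * .X ^ 2 + .C (-2 * AdjoinSimple.gen ℚ c) * .X + .C 1
      have hp : p.natDegree = 2 := Polynomial.natDegree_quadratic one_ne_zero
      have hp0 : p ≠ 0 := Polynomial.ne_zero_of_natDegree_gt (n := 0) (by omega)
      rw [← hp]
      refine Polynomial.natDegree_le_of_dvd (minpoly.dvd _ _ ?_) hp0
      simp only [p, map_add, map_mul, map_pow, Polynomial.aeval_X, Polynomial.aeval_C, map_neg,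
        map_one, map_ofNat, AdjoinSimple.algebraMap_gen]
      linear_combination hquad
    · rintro ⟨x, hx⟩
      exact hζnot (hx ▸ x.2)
  have hfield : (ℚ⟮c⟯⟮ζ⟯).restrictScalars ℚ = ℚ⟮ζ⟯ := by
    refine (adjoin_simple_adjoin_simple ℚ c ζ).trans ?_
    refine le_antisymm (adjoin_le_iff.2 ?_) (adjoin.mono _ _ _ (by simp))
    rintro x (rfl | rfl)
    exacts [hcmem, mem_adjoin_simple_self ℚ _]
  have hfinrank : Module.finrank ℚ ℚ⟮c⟯ * Module.finrank ℚ⟮c⟯ ℚ⟮c⟯⟮ζ⟯ =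
      Module.finrank ℚ ℚ⟮ζ⟯ := by
    rw [Module.finrank_mul_finrank, ← hfield]
    rfl
  rw [adjoin.finrank hcint, adjoin.finrank hζint.tower_top, adjoin.finrank hζint, hdeg,
    ← Polynomial.cyclotomic_eq_minpoly_rat h (by omega), Polynomial.natDegree_cyclotomic]
    at hfinrank
  have hmin : minpoly ℚ c = minpoly ℚ (Real.cos θ) :=
    minpoly.algebraMap_eq (algebraMap ℝ ℂ).injective (Real.cos θ)
  rw [← hmin]
  omega

theorem natDegree_minpoly_cos_two_pi_mul_div {N : ℕ} (hN : 2 < N) {a : ℤ} (ha : Int.gcd a N = 1) :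
    (minpoly ℚ (Real.cos (2 * Real.pi * a / N))).natDegree = N.totient / 2 := by
  apply natDegree_minpoly_cos_of_isPrimitiveRoot hN
  have hexp : Complex.exp ((2 * Real.pi * a / N : ℝ) * Complex.I) =
      Complex.exp (2 * Real.pi * Complex.I / N) ^ a := by
    rw [← Complex.exp_int_mul]
    push_cast
    ring_nf
  rw [hexp]
  exact (Complex.isPrimitiveRoot_exp N (by omega)).zpow_of_gcd_eq_one a ha

/-- If `(4k - n) / (4n) = a / N` with `a` and `N > 2` coprime, then `sin (2kπ/n)` has degree
`φ N / 2` over `ℚ`. -/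
theorem natDegree_minpoly_sin_two_pi_mul_div {n N : ℕ} (hn : n ≠ 0) (hN : 2 < N) {k a : ℤ}
    (ha : Int.gcd a N = 1) (h : (4 * k - n) * N = a * (4 * n)) :
    (minpoly ℚ (Real.sin (2 * k * Real.pi / n))).natDegree = N.totient / 2 := by
  rw [← natDegree_minpoly_cos_two_pi_mul_div hN ha, ← Real.cos_sub_pi_div_two]
  have hN0 : (N : ℝ) ≠ 0 := by positivity
  have hn0 : (n : ℝ) ≠ 0 := by positivity
  have h' : (4 * k - n : ℝ) * N = a * (4 * n) := by exact_mod_cast h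
  congr 3
  field_simp
  linear_combination h'

/-- Complexity Theorem, part (ii) (Lehmer, corrected): for an integer `n > 2`
with `n ≠ 4` and an integer `k` with `gcd(k, n) = 1`, the degree of
`sin(2kπ/n)` over `ℚ` is `φ(n)` if `4 ∤ n`, `φ(n)/2` if `n ≡ 0 (mod 8)`, and
`φ(n)/4` if `n ≡ 4 (mod 8)`. -/
theorem sin_degree (n : ℕ) (hn : 2 < n) (hn4 : n ≠ 4) (k : ℤ) (hk : Int.gcd k n = 1) :
    (¬ (4 ∣ n) →
      (minpoly ℚ (Real.sin (2 * k * Real.pi / n))).natDegree = n.totient) ∧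
    (n % 8 = 0 →
      (minpoly ℚ (Real.sin (2 * k * Real.pi / n))).natDegree = n.totient / 2) ∧
    (n % 8 = 4 →
      (minpoly ℚ (Real.sin (2 * k * Real.pi / n))).natDegree = n.totient / 4) := by
  have hcop : IsCoprime k (n : ℤ) := Int.isCoprime_iff_gcd_eq_one.2 hk
  have isCoprime_two {a : ℤ} (ha : a % 2 = 1) : IsCoprime a 2 := ⟨1, -(a / 2), by omega⟩
  have k_odd (hn2 : n % 2 = 0) : k % 2 = 1 := by
    obtain ⟨m, rfl⟩ : 2 ∣ n := by omega
    obtain ⟨u, v, huv⟩ := hcop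
    by_contra hk2
    obtain ⟨l, rfl⟩ : 2 ∣ k := by omega
    have : 2 * (u * l + v * m) = 1 := by
      push_cast at huv
      linear_combination huv
    omega
  refine ⟨fun h => ?_, fun h => ?_, fun h => ?_⟩
  · rcases Nat.mod_two_eq_zero_or_one n with h2 | h2
    · obtain ⟨m, rfl⟩ : 2 ∣ n := by omega
      have hodd : IsCoprime (2 * k - m) 2 := isCoprime_two (by omega)
      have hm : IsCoprime (2 * k - m) (m : ℤ) := by
        have h2m : IsCoprime (2 : ℤ) m := (isCoprime_two (by omega)).symm
        have hkm : IsCoprime k (m : ℤ) := by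
          push_cast at hcop
          exact hcop.of_mul_right_right
        simpa [sub_eq_add_neg] using (h2m.mul_left hkm).add_mul_right_left (-1)
      rw [natDegree_minpoly_sin_two_pi_mul_div (N := 2 * (2 * m)) (a := 2 * k - m) (by omega)
        (by omega) ?_ (by push_cast; ring), Nat.totient_two_mul_of_even (by simp)]
      · omega
      · rw [← Int.isCoprime_iff_gcd_eq_one]
        push_cast
        exact hodd.mul_right (hodd.mul_right hm)
    · have hodd : IsCoprime (4 * k - n) 2 := isCoprime_two (by omega)
      have hn' : IsCoprime (4 * k - n) (n : ℤ) := by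
        have h2n : IsCoprime (2 : ℤ) n := (isCoprime_two (by omega)).symm
        have h4n : IsCoprime (4 : ℤ) n := h2n.mul_left h2n
        simpa [sub_eq_add_neg] using (h4n.mul_left hcop).add_mul_right_left (-1)
      rw [natDegree_minpoly_sin_two_pi_mul_div (N := 2 * (2 * n)) (a := 4 * k - n) (by omega)
        (by omega) ?_ (by push_cast; ring), Nat.totient_two_mul_of_even (by simp),
        Nat.totient_two_mul_of_odd (Nat.odd_iff.2 h2)]
      · omega
      · rw [← Int.isCoprime_iff_gcd_eq_one]
        push_cast
        exact hodd.mul_right (hodd.mul_right hn')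
  · have hk2 := k_odd (by omega)
    obtain ⟨m, rfl⟩ : 4 ∣ n := by omega
    have hodd : IsCoprime (k - m) 2 := isCoprime_two (by omega)
    have hm : IsCoprime (k - m) (m : ℤ) := by
      push_cast at hcop
      simpa [sub_eq_add_neg] using hcop.of_mul_right_right.add_mul_right_left (-1)
    refine natDegree_minpoly_sin_two_pi_mul_div (a := k - m) (by omega) (by omega) ?_
      (by push_cast; ring)
    rw [← Int.isCoprime_iff_gcd_eq_one]
    push_cast
    exact (hodd.mul_right hodd).mul_right hm
  · have hk2 := k_odd (by omega)
    obtain ⟨m, rfl⟩ : 4 ∣ n := by omega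
    have hm_odd : Odd m := Nat.odd_iff.2 (by omega)
    have hm : IsCoprime (k - m) (m : ℤ) := by
      push_cast at hcop
      simpa [sub_eq_add_neg] using hcop.of_mul_right_right.add_mul_right_left (-1)
    have htot : (4 * m).totient = 2 * m.totient := by
      rw [show 4 * m = 2 * (2 * m) by ring, Nat.totient_two_mul_of_even (by simp),
        Nat.totient_two_mul_of_odd hm_odd]
    obtain ⟨b, hb⟩ : 2 ∣ k - m := by omega
    rw [hb] at hm
    rcases Int.emod_two_eq_zero_or_one b with hb2 | hb2
    · obtain ⟨d, rfl⟩ : 2 ∣ b := by omega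
      rw [natDegree_minpoly_sin_two_pi_mul_div (N := m) (a := d) (by omega) (by omega)
        (Int.isCoprime_iff_gcd_eq_one.1 hm.of_mul_left_right.of_mul_left_right)
        (by push_cast; linear_combination 4 * (m : ℤ) * hb)]
      omega
    · rw [natDegree_minpoly_sin_two_pi_mul_div (N := 2 * m) (a := b) (by omega) (by omega) ?_
        (by push_cast; linear_combination 8 * (m : ℤ) * hb), Nat.totient_two_mul_of_odd hm_odd]
      · omega
      · rw [← Int.isCoprime_iff_gcd_eq_one]
        push_cast
        exact (isCoprime_two hb2).mul_right hm.of_mul_left_right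
end
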